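/- arXiv:2010.03354 — 5 statements merged into one kernel-verified Lean document; each statement's English description precedes it below -/
import Mathlib

section
/- Let G be an interval graph. An ordering σ of V(G) is an interval ordering of G if and only if σ is consistent with some clique path of G. -/
open SimpleGraph

/-- `G` is an interval graph: each vertex can be assigned a closed real interval so that
distinct vertices are adjacent iff their intervals intersect. -/
def IsIntervalGraph {V : Type*} (G : SimpleGraph V) : Prop :=
  ∃ I : V → Set ℝ,
    (∀ v, ∃ a b : ℝ, a ≤ b ∧ I v = Set.Icc a b) ∧
    ∀ u v : V, u ≠ v → (G.Adj u v ↔ (I u ∩ I v).Nonempty)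

section Orderings

variable {V : Type*} [Finite V]

/-- An interval ordering: for `u <σ v <σ w`, `uw ∈ E` implies `uv ∈ E`. -/
def IsIntervalOrdering (G : SimpleGraph V) (σ : V ≃ Fin (Nat.card V)) : Prop :=
  ∀ u v w : V, σ u < σ v → σ v < σ w → G.Adj u w → G.Adj u v

/-- An umbrella ordering: for `u <σ v <σ w`, `uw ∈ E` iff `uv ∈ E` and `vw ∈ E`. -/
def IsUmbrellaOrdering (G : SimpleGraph V) (σ : V ≃ Fin (Nat.card V)) : Prop :=
  ∀ u v w : V, σ u < σ v → σ v < σ w → (G.Adj u w ↔ G.Adj u v ∧ G.Adj v w)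

/-- A unit interval graph: a graph admitting an umbrella ordering. -/
def IsUnitIntervalGraph (G : SimpleGraph V) : Prop :=
  ∃ σ : V ≃ Fin (Nat.card V), IsUmbrellaOrdering G σ

/-- An LBFS ordering: for all `a <σ b <σ c` with `ac ∈ E` and `ab ∉ E` there is `d <σ a`
with `db ∈ E` and `dc ∉ E`. -/
def IsLBFSOrdering (G : SimpleGraph V) (σ : V ≃ Fin (Nat.card V)) : Prop :=
  ∀ a b c : V, σ a < σ b → σ b < σ c → G.Adj a c → ¬ G.Adj a b →
    ∃ d : V, σ d < σ a ∧ G.Adj d b ∧ ¬ G.Adj d c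

/-- An end vertex: the last vertex of some LBFS ordering. -/
def IsEndVertex (G : SimpleGraph V) (v : V) : Prop :=
  ∃ σ : V ≃ Fin (Nat.card V), IsLBFSOrdering G σ ∧ ∀ u, σ u ≤ σ v

/-- `N_σ(v)`: the neighbors of `v` preceding `v` in `σ`. -/
def earlyNbhd (G : SimpleGraph V) (σ : V ≃ Fin (Nat.card V)) (v : V) : Set V :=
  {u | σ u < σ v ∧ G.Adj u v}

/-- The snapshot `S_σ(v)`: vertices `w` not before `v` whose neighborhood among the
vertices preceding `v` equals `N_σ(v)`. -/
def snapshot (G : SimpleGraph V) (σ : V ≃ Fin (Nat.card V)) (v : V) : Set V :=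
  {w | σ v ≤ σ w ∧ {u | σ u < σ v ∧ G.Adj u w} = earlyNbhd G σ v}

/-- `τ = LBFS⁺(G, σ)`: `τ` is an LBFS ordering and every vertex is the `σ`-last vertex of
its own `τ`-snapshot. -/
def IsLBFSPlusOf (G : SimpleGraph V) (σ τ : V ≃ Fin (Nat.card V)) : Prop :=
  IsLBFSOrdering G τ ∧ ∀ v w : V, w ∈ snapshot G τ v → σ w ≤ σ v

/-- `v` is exposed from the snapshot `S_σ(x)` in `σ`:
`v ∈ S_σ(x)` and `N(v) \ (N_σ(S) ∪ S) ≠ ∅`. -/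
def ExposedFrom (G : SimpleGraph V) (σ : V ≃ Fin (Nat.card V)) (x v : V) : Prop :=
  v ∈ snapshot G σ x ∧
    (G.neighborSet v \ (earlyNbhd G σ x ∪ snapshot G σ x)).Nonempty

/-- `x` is an end vertex of the subgraph of `G` induced by `S`. -/
def IsEndVertexOn (G : SimpleGraph V) (S : Set V) (x : V) : Prop :=
  ∃ hx : x ∈ S, IsEndVertex (G.induce S) ⟨x, hx⟩

/-- A well-anchored LBFS ordering: each snapshot starts from an exposed vertex if
one exists, and from an end vertex of the induced subgraph otherwise. -/
def IsWellAnchored (G : SimpleGraph V) (σ : V ≃ Fin (Nat.card V)) : Prop :=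
  IsLBFSOrdering G σ ∧ ∀ x : V,
    ((∃ v, ExposedFrom G σ x v) → ExposedFrom G σ x x) ∧
    (¬ (∃ v, ExposedFrom G σ x v) → IsEndVertexOn G (snapshot G σ x) x)

/-- An MCS ordering: each vertex has at least as many earlier neighbors as any
later vertex has among the vertices before it. -/
def IsMCSOrdering (G : SimpleGraph V) (σ : V ≃ Fin (Nat.card V)) : Prop :=
  ∀ v w : V, σ v < σ w →
    {u | σ u < σ v ∧ G.Adj u w}.ncard ≤ (earlyNbhd G σ v).ncard

end Orderings

section CliquePaths

variable {V : Type*}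

/-- A clique path: an injective enumeration of all maximal cliques of `G` such that
for each vertex the set of indices of cliques containing it is a nonempty interval. -/
structure IsCliquePath (G : SimpleGraph V) {ℓ : ℕ} (K : Fin ℓ → Finset V) : Prop where
  injective : Function.Injective K
  maxClique : ∀ i, Maximal G.IsClique (K i : Set V)
  complete : ∀ s : Set V, Maximal G.IsClique s → ∃ i, (K i : Set V) = s
  covers : ∀ v : V, ∃ i, v ∈ K i
  consecutive : ∀ (v : V) (i j k : Fin ℓ), i ≤ j → j ≤ k → v ∈ K i → v ∈ K k → v ∈ K j

/-- `i` is `lp(v)`: the smallest index of a clique containing `v`. -/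
def IsLp {ℓ : ℕ} (K : Fin ℓ → Finset V) (v : V) (i : Fin ℓ) : Prop :=
  v ∈ K i ∧ ∀ j, v ∈ K j → i ≤ j

/-- `i` is `rp(v)`: the largest index of a clique containing `v`. -/
def IsRp {ℓ : ℕ} (K : Fin ℓ → Finset V) (v : V) (i : Fin ℓ) : Prop :=
  v ∈ K i ∧ ∀ j, v ∈ K j → j ≤ i

/-- An ordering is consistent with a clique path if `u <σ v` whenever `lp(u) < lp(v)`. -/
def ConsistentWith [Finite V] {ℓ : ℕ} (σ : V ≃ Fin (Nat.card V))
    (K : Fin ℓ → Finset V) : Prop :=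
  ∀ (u v : V) (iu iv : Fin ℓ), IsLp K u iu → IsLp K v iv → iu < iv → σ u < σ v

/-- A simplicial vertex: its closed neighborhood is a clique. -/
def IsSimplicial (G : SimpleGraph V) (v : V) : Prop :=
  G.IsClique (insert v (G.neighborSet v))

/-- A module of `G`: every outside vertex is adjacent to all of `M` or to none of `M`. -/
def IsGraphModule (G : SimpleGraph V) (M : Set V) : Prop :=
  ∀ x ∉ M, (∀ v ∈ M, G.Adj x v) ∨ (∀ v ∈ M, ¬ G.Adj x v)

/-- True twins: adjacent vertices with the same closed neighborhood. -/
def AreTrueTwins (G : SimpleGraph V) (u v : V) : Prop :=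
  G.Adj u v ∧ insert u (G.neighborSet u) = insert v (G.neighborSet v)

end CliquePaths

section EarlyClosedNbhd

variable {V : Type*} {G : SimpleGraph V} {σ : V ≃ Fin (Nat.card V)}

/-- The closed early neighborhood: `v` together with its neighbors preceding it in `σ`. -/
def earlyClosedNbhd (G : SimpleGraph V) (σ : V ≃ Fin (Nat.card V)) (v : V) : Set V :=
  insert v (earlyNbhd G σ v)

theorem mem_earlyClosedNbhd_self (v : V) : v ∈ earlyClosedNbhd G σ v :=
  Set.mem_insert _ _

theorem mem_earlyClosedNbhd_of_adj {u v : V} (huv : σ u < σ v) (h : G.Adj u v) :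
    u ∈ earlyClosedNbhd G σ v :=
  Set.mem_insert_of_mem _ ⟨huv, h⟩

theorem le_of_mem_earlyClosedNbhd {u v : V} (h : u ∈ earlyClosedNbhd G σ v) : σ u ≤ σ v := by
  rcases h with rfl | h
  exacts [le_rfl, h.1.le]

theorem adj_of_mem_earlyClosedNbhd {u v : V} (h : u ∈ earlyClosedNbhd G σ v)
    (huv : σ u < σ v) : G.Adj u v := by
  rcases h with rfl | h
  exacts [absurd huv (lt_irrefl _), h.2]

theorem earlyClosedNbhd_injective : Function.Injective (earlyClosedNbhd G σ) := fun u v h =>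
  σ.injective <| le_antisymm
    (le_of_mem_earlyClosedNbhd (h ▸ mem_earlyClosedNbhd_self u))
    (le_of_mem_earlyClosedNbhd (h ▸ mem_earlyClosedNbhd_self v))

theorem IsIntervalOrdering.isClique_earlyClosedNbhd (hσ : IsIntervalOrdering G σ) (v : V) :
    G.IsClique (earlyClosedNbhd G σ v) := by
  refine isClique_insert.2 ⟨fun a ha b hb hab => ?_, fun b hb _ => hb.2.symm⟩
  rcases lt_or_gt_of_ne (σ.injective.ne hab) with h | h
  · exact hσ a b v h hb.1 ha.2
  · exact (hσ b a v h ha.1 hb.2).symm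

/-- Membership in closed early neighborhoods propagates down to any earlier vertex that
does not precede the member. -/
theorem IsIntervalOrdering.mem_earlyClosedNbhd_of_le (hσ : IsIntervalOrdering G σ) {u v w : V}
    (huv : σ u ≤ σ v) (hvw : σ v < σ w) (h : u ∈ earlyClosedNbhd G σ w) :
    u ∈ earlyClosedNbhd G σ v := by
  rcases huv.eq_or_lt with e | hlt
  · rw [σ.injective e]
    exact mem_earlyClosedNbhd_self v
  · exact mem_earlyClosedNbhd_of_adj hlt
      (hσ u v w hlt hvw (adj_of_mem_earlyClosedNbhd h (hlt.trans hvw)))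

/-- A nonempty maximal clique is the closed early neighborhood of its last vertex. -/
theorem IsIntervalOrdering.exists_earlyClosedNbhd_eq [Finite V] (hσ : IsIntervalOrdering G σ)
    {s : Set V} (hs : Maximal G.IsClique s) (hne : s.Nonempty) : ∃ v, earlyClosedNbhd G σ v = s := by
  obtain ⟨m, hm, hmax⟩ := Set.exists_max_image s σ s.toFinite hne
  have hsub : s ⊆ earlyClosedNbhd G σ m := fun u hu => by
    rcases (hmax u hu).eq_or_lt with e | hlt
    · rw [σ.injective e]
      exact mem_earlyClosedNbhd_self m
    · exact mem_earlyClosedNbhd_of_adj hlt (hs.prop hu hm fun e => hlt.ne (congrArg σ e))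
  exact ⟨m, (hs.eq_of_subset (hσ.isClique_earlyClosedNbhd m) hsub).symm⟩

end EarlyClosedNbhd

section ExistsMaximalClique

variable {V : Type*} {G : SimpleGraph V}

theorem SimpleGraph.IsClique.exists_maximal_superset [Finite V] {s : Set V} (hs : G.IsClique s) :
    ∃ t, s ⊆ t ∧ Maximal G.IsClique t :=
  Finite.exists_le_maximal hs

theorem Maximal.nonempty_of_isClique [Nonempty V] {s : Set V} (hs : Maximal G.IsClique s) :
    s.Nonempty := by
  rw [Set.nonempty_iff_ne_empty]
  rintro rfl
  obtain ⟨v⟩ := ‹Nonempty V›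
  exact hs.le_of_ge (isClique_singleton v) (Set.empty_subset _) (Set.mem_singleton v)

end ExistsMaximalClique

section CliquePathOrderings

variable {V : Type*} {G : SimpleGraph V} {ℓ : ℕ} {K : Fin ℓ → Finset V}

theorem IsCliquePath.exists_isLp (hK : IsCliquePath G K) (v : V) : ∃ i, IsLp K v i := by
  obtain ⟨i, hi, hmin⟩ := Set.exists_min_image {i | v ∈ K i} id (Set.toFinite _) (hK.covers v)
  exact ⟨i, hi, hmin⟩

theorem isCliquePath_of_isEmpty [IsEmpty V] (G : SimpleGraph V) :
    IsCliquePath G (fun _ : Fin 1 => (∅ : Finset V)) where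
  injective := Function.injective_of_subsingleton _
  maxClique _ := ⟨by simp, fun _ _ _ v => isEmptyElim v⟩
  complete s _ := ⟨0, Subsingleton.elim _ _⟩
  covers v := isEmptyElim v
  consecutive v := isEmptyElim v

variable [Finite V] {σ : V ≃ Fin (Nat.card V)}

theorem IsCliquePath.exists_mem_of_adj (hK : IsCliquePath G K) {u v : V} (h : G.Adj u v) :
    ∃ i, u ∈ K i ∧ v ∈ K i := by
  obtain ⟨t, hst, ht⟩ := (isClique_pair.2 fun _ => h : G.IsClique {u, v}).exists_maximal_superset
  obtain ⟨i, rfl⟩ := hK.complete t ht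
  exact ⟨i, hst (Set.mem_insert _ _), hst (Set.mem_insert_of_mem _ rfl)⟩

theorem ConsistentWith.isIntervalOrdering (hK : IsCliquePath G K) (hσ : ConsistentWith σ K) :
    IsIntervalOrdering G σ := by
  intro u v w huv hvw huw
  obtain ⟨a, ha⟩ := hK.exists_isLp u
  obtain ⟨b, hb⟩ := hK.exists_isLp v
  obtain ⟨c, hc⟩ := hK.exists_isLp w
  obtain ⟨i, hui, hwi⟩ := hK.exists_mem_of_adj huw
  have hab : a ≤ b := not_lt.1 fun h => (hσ v u b a hb ha h).not_gt huv
  have hbc : b ≤ c := not_lt.1 fun h => (hσ w v c b hc hb h).not_gt hvw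
  have hub : u ∈ K b := hK.consecutive u a b i hab (hbc.trans (hc.2 i hwi)) ha.1 hui
  exact (hK.maxClique b).prop hub hb.1 fun e => huv.ne (congrArg σ e)

/-- The maximal cliques, sorted by their last vertices, form a clique path consistent with
a given interval ordering. -/
theorem IsIntervalOrdering.exists_consistentWith (hσ : IsIntervalOrdering G σ) :
    ∃ (ℓ : ℕ) (K : Fin ℓ → Finset V), IsCliquePath G K ∧ ConsistentWith σ K := by
  classical
  rcases isEmpty_or_nonempty V with hV | hV
  · exact ⟨1, _, isCliquePath_of_isEmpty G, fun u => isEmptyElim u⟩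
  let S : Finset (Fin (Nat.card V)) :=
    {i | Maximal G.IsClique (earlyClosedNbhd G σ (σ.symm i))}
  let m : Fin S.card → V := fun i => σ.symm (S.orderEmbOfFin rfl i)
  have hm : ∀ {i j}, i < j → σ (m i) < σ (m j) := fun {i j} h => by simpa [m] using h
  let K : Fin S.card → Finset V := fun i => (Set.toFinite (earlyClosedNbhd G σ (m i))).toFinset
  have hcoe : ∀ i, (K i : Set V) = earlyClosedNbhd G σ (m i) := fun i => Set.Finite.coe_toFinset _
  have hmem : ∀ {v i}, v ∈ K i ↔ v ∈ earlyClosedNbhd G σ (m i) := Set.Finite.mem_toFinset _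
  have hcomplete : ∀ s : Set V, Maximal G.IsClique s → ∃ i, (K i : Set V) = s := by
    intro s hs
    obtain ⟨v, rfl⟩ := hσ.exists_earlyClosedNbhd_eq hs hs.nonempty_of_isClique
    have hv : σ v ∈ Set.range (S.orderEmbOfFin rfl) := by
      rw [Finset.range_orderEmbOfFin]
      simpa [S] using hs
    obtain ⟨i, hi⟩ := hv
    exact ⟨i, by simp [hcoe, m, hi]⟩
  refine ⟨S.card, K, ⟨fun i j h => ?_, fun i => ?_, hcomplete, fun v => ?_, ?_⟩, ?_⟩
  · have hij : m i = m j := earlyClosedNbhd_injective (by rw [← hcoe, ← hcoe, h])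
    exact (S.orderEmbOfFin rfl).injective (σ.symm.injective hij)
  · rw [hcoe]
    exact (Finset.mem_filter.1 (S.orderEmbOfFin_mem rfl i)).2
  · obtain ⟨t, hvt, ht⟩ := (isClique_singleton v : G.IsClique {v}).exists_maximal_superset
    obtain ⟨i, rfl⟩ := hcomplete t ht
    exact ⟨i, hvt rfl⟩
  · intro v i j k hij hjk hi hk
    rcases hij.eq_or_lt with rfl | hij
    · exact hi
    rcases hjk.eq_or_lt with rfl | hjk
    · exact hk
    rw [hmem] at hi hk ⊢
    exact hσ.mem_earlyClosedNbhd_of_le ((le_of_mem_earlyClosedNbhd hi).trans (hm hij).le)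
      (hm hjk) hk
  · intro u v i j hu hv hij
    by_contra! hle
    have hvi : v ∈ K i := hmem.2 <| hσ.mem_earlyClosedNbhd_of_le
      (hle.trans (le_of_mem_earlyClosedNbhd (hmem.1 hu.1))) (hm hij) (hmem.1 hv.1)
    exact (hv.2 i hvi).not_gt hij

end CliquePathOrderings

/-- an ordering of an interval graph is an interval ordering iff it is
consistent with some clique path. -/
theorem interval_ordering_iff_consistent_with_clique_path {V : Type*} [Finite V]
    (G : SimpleGraph V) (hG : IsIntervalGraph G) (σ : V ≃ Fin (Nat.card V)) :
    IsIntervalOrdering G σ ↔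
      ∃ (ℓ : ℕ) (K : Fin ℓ → Finset V), IsCliquePath G K ∧ ConsistentWith σ K := by
  refine ⟨fun h => h.exists_consistentWith, ?_⟩
  rintro ⟨ℓ, K, hK, hσ⟩
  exact hσ.isIntervalOrdering hK
end

section
/- Let G be an interval graph in which every nontrivial module is a set of pairwise true twins. Then G has a unique clique path up to full reversal: any two clique paths of G are either identical or the reversal of each other. -/
open SimpleGraph

section CommonIntervals

variable {X α β : Type*} [LinearOrder α] [LinearOrder β]

/-- `S` is an interval for the order on `X` induced by `p`. -/
def IsConvexUnder (p : X → α) (S : Set X) : Prop :=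
  ∀ ⦃x y z⦄, p x ≤ p y → p y ≤ p z → x ∈ S → z ∈ S → y ∈ S

/-- `S` is an initial segment for the order on `X` induced by `p`. -/
def IsLowerUnder (p : X → α) (S : Set X) : Prop :=
  ∀ ⦃x y⦄, p x ≤ p y → y ∈ S → x ∈ S

/-- Two sets overlap if they meet and neither contains the other. -/
def Overlap (S T : Set X) : Prop :=
  (S ∩ T).Nonempty ∧ (S \ T).Nonempty ∧ (T \ S).Nonempty

theorem IsConvexUnder.toDual {p : X → α} {S : Set X} (h : IsConvexUnder p S) :
    IsConvexUnder (OrderDual.toDual ∘ p) S :=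
  fun _ _ _ hxy hyz hx hz => h hyz hxy hz hx

theorem IsConvexUnder.union {p : X → α} {S T : Set X} (hS : IsConvexUnder p S)
    (hT : IsConvexUnder p T) (hST : (S ∩ T).Nonempty) : IsConvexUnder p (S ∪ T) := by
  obtain ⟨w, hwS, hwT⟩ := hST
  rintro x y z hxy hyz (hx | hx) (hz | hz)
  · exact Or.inl (hS hxy hyz hx hz)
  · rcases le_total (p y) (p w) with h | h
    · exact Or.inl (hS hxy h hx hwS)
    · exact Or.inr (hT h hyz hwT hz)
  · rcases le_total (p y) (p w) with h | h
    · exact Or.inr (hT hxy h hx hwT)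
    · exact Or.inl (hS h hyz hwS hz)
  · exact Or.inr (hT hxy hyz hx hz)

theorem IsConvexUnder.union_isLowerUnder {p : X → α} {P J : Set X} (hP : IsLowerUnder p P)
    (hJ : IsConvexUnder p J) (hPJ : (P ∩ J).Nonempty) : IsLowerUnder p (P ∪ J) := by
  obtain ⟨b, hbP, hbJ⟩ := hPJ
  rintro x y hxy (hy | hy)
  · exact Or.inl (hP hxy hy)
  · rcases le_total (p x) (p b) with h | h
    · exact Or.inl (hP h hbP)
    · exact Or.inr (hJ h hxy hbJ hy)

theorem IsConvexUnder.diff_isLowerUnder {p : X → α} {Q J : Set X} (hQ : IsLowerUnder p Q)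
    (hJ : IsConvexUnder p J) (hJQ : (J \ Q).Nonempty) : IsLowerUnder p (Q \ J) := by
  obtain ⟨b, hbJ, hbQ⟩ := hJQ
  rintro x y hxy ⟨hyQ, hyJ⟩
  refine ⟨hQ hxy hyQ, fun hxJ => hyJ (hJ hxy ?_ hxJ hbJ)⟩
  exact (le_total (p y) (p b)).resolve_right fun h => hbQ (hQ h hyQ)

/-- Two intervals whose union is everything, neither of which is everything, are segments
at the two ends. -/
theorem IsConvexUnder.isLowerUnder_or_compl [Finite X] {p : X → α} {S T : Set X}
    (hS : IsConvexUnder p S) (hT : IsConvexUnder p T) (hST : S ∪ T = Set.univ)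
    (hS' : S ≠ Set.univ) (hT' : T ≠ Set.univ) :
    IsLowerUnder p S ∨ IsLowerUnder p Sᶜ := by
  obtain ⟨s, -⟩ := (Set.ne_univ_iff_exists_notMem S).1 hS'
  have : Nonempty X := ⟨s⟩
  obtain ⟨m, hm⟩ := Finite.exists_min p
  obtain ⟨M, hM⟩ := Finite.exists_max p
  by_cases hmS : m ∈ S
  · exact Or.inl fun x y hxy hy => hS (hm x) hxy hmS hy
  by_cases hMS : M ∈ S
  · exact Or.inr fun x y hxy hy hx => hy (hS hxy (hM y) hx hMS)
  have hmT : m ∈ T := (hST ▸ Set.mem_univ m : m ∈ S ∪ T).resolve_left hmS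
  have hMT : M ∈ T := (hST ▸ Set.mem_univ M : M ∈ S ∪ T).resolve_left hMS
  exact absurd (Set.eq_univ_of_forall fun x => hT (hm x) (hM x) hmT hMT) hT'

/-- If every nontrivial set is overlapped by a common interval of two orders, and the two
orders have a common proper initial segment, then they agree. -/
theorem lt_of_lt_of_common_isLowerUnder {p : X → α} {q : X → β} (hq : Function.Injective q)
    (hF : ∀ B : Set X, B.Nontrivial → B ≠ Set.univ →
      ∃ J, IsConvexUnder p J ∧ IsConvexUnder q J ∧ Overlap J B)
    {C : Set X} (hCp : IsLowerUnder p C) (hCq : IsLowerUnder q C) (hC : C.Nonempty)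
    (hC' : C ≠ Set.univ) {x y : X} (hxy : p x < p y) : q x < q y := by
  by_contra hcon
  have hyx : q y < q x :=
    lt_of_le_of_ne (not_lt.1 hcon) fun h => hxy.ne (congrArg p (hq h)).symm
  let L : Set X → Prop := fun S => IsLowerUnder p S ∧ IsLowerUnder q S
  let P : Set X := {z | ∃ S, L S ∧ x ∉ S ∧ z ∈ S}
  let Q : Set X := {z | ∀ S, L S → x ∈ S → z ∈ S}
  have hP : L P :=
    ⟨fun a b hab ⟨S, hS, hx, hb⟩ => ⟨S, hS, hx, hS.1 hab hb⟩,
      fun a b hab ⟨S, hS, hx, hb⟩ => ⟨S, hS, hx, hS.2 hab hb⟩⟩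
  have hQ : L Q :=
    ⟨fun a b hab hb S hS hx => hS.1 hab (hb S hS hx),
      fun a b hab hb S hS hx => hS.2 hab (hb S hS hx)⟩
  have key : ∀ S, L S → S ⊆ P ∨ Q ⊆ S := fun S hS => by
    by_cases hx : x ∈ S
    · exact Or.inr fun z hz => hz S hS hx
    · exact Or.inl fun z hz => ⟨S, hS, hx, hz⟩
  have hxB : x ∈ Q \ P := ⟨fun _ _ h => h, fun ⟨_, _, h, h'⟩ => h h'⟩
  have hyB : y ∈ Q \ P :=
    ⟨fun _ hS h => hS.2 hyx.le h, fun ⟨_, hS, h, h'⟩ => h (hS.1 hxy.le h')⟩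
  have hB : Q \ P ≠ Set.univ := by
    intro hB
    rcases key C ⟨hCp, hCq⟩ with h | h
    · obtain ⟨c, hc⟩ := hC
      exact (hB ▸ Set.mem_univ c : c ∈ Q \ P).2 (h hc)
    · exact hC' (Set.eq_univ_of_forall fun z => h (hB ▸ Set.mem_univ z : z ∈ Q \ P).1)
  obtain ⟨J, hJp, hJq, ⟨a, haJ, haQ, haP⟩, ⟨b, hbJ, hbB⟩, ⟨c, ⟨hcQ, hcP⟩, hcJ⟩⟩ :=
    hF _ ⟨x, hxB, y, hyB, fun h => hxy.ne (congrArg p h)⟩ hB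
  by_cases hbQ : b ∈ Q
  · have hbP : b ∈ P := by_contra fun h => hbB ⟨hbQ, h⟩
    rcases key (P ∪ J) ⟨hJp.union_isLowerUnder hP.1 ⟨b, hbP, hbJ⟩,
      hJq.union_isLowerUnder hP.2 ⟨b, hbP, hbJ⟩⟩ with h | h
    · exact haP (h (Or.inr haJ))
    · exact (h hcQ).elim hcP hcJ
  · rcases key (Q \ J) ⟨hJp.diff_isLowerUnder hQ.1 ⟨b, hbJ, hbQ⟩,
      hJq.diff_isLowerUnder hQ.2 ⟨b, hbJ, hbQ⟩⟩ with h | h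
    · exact hcP (h ⟨hcQ, hcJ⟩)
    · exact (h haQ).2 haJ

/-- If every nontrivial set is overlapped by a common interval of two orders on a finite type,
then the two orders are equal or reverse to each other. -/
theorem lt_imp_lt_or_lt_imp_gt_of_overlap [Finite X] {p : X → α} {q : X → β}
    (hq : Function.Injective q)
    (hF : ∀ B : Set X, B.Nontrivial → B ≠ Set.univ →
      ∃ J, IsConvexUnder p J ∧ IsConvexUnder q J ∧ Overlap J B) :
    (∀ x y, p x < p y → q x < q y) ∨ (∀ x y, p x < p y → q y < q x) := by
  let R : Set X → Prop := fun M =>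
    IsConvexUnder p M ∧ IsConvexUnder q M ∧ M.Nontrivial ∧ M ≠ Set.univ
  by_cases hR : ∃ M, R M
  · obtain ⟨M₀, hM₀⟩ := hR
    obtain ⟨M, -, ⟨hMp, hMq, hM, hM'⟩, hmax⟩ := Finite.exists_le_maximal hM₀
    obtain ⟨N, hNp, hNq, ⟨w, hwN, hwM⟩, ⟨b, hbN, hbM⟩, ⟨c, hcM, hcN⟩⟩ := hF M hM hM'
    have hMN : M ∪ N = Set.univ := by
      by_contra hne
      exact hbM (hmax ⟨hMp.union hNp ⟨w, hwM, hwN⟩, hMq.union hNq ⟨w, hwM, hwN⟩,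
        hM.mono Set.subset_union_left, hne⟩ Set.subset_union_left (Or.inr hbN))
    have hN' : N ≠ Set.univ := fun h => hcN (h ▸ Set.mem_univ c)
    have hF' : ∀ B : Set X, B.Nontrivial → B ≠ Set.univ →
        ∃ J, IsConvexUnder p J ∧ IsConvexUnder (OrderDual.toDual ∘ q) J ∧ Overlap J B :=
      fun B h h' => let ⟨J, h1, h2, h3⟩ := hF B h h'; ⟨J, h1, h2.toDual, h3⟩
    have hMc : Mᶜ.Nonempty := ⟨b, hbM⟩
    have hMc' : Mᶜ ≠ Set.univ := fun h => (h ▸ Set.mem_univ w : w ∈ Mᶜ) hwM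
    have hq' : Function.Injective (OrderDual.toDual ∘ q) := OrderDual.toDual.injective.comp hq
    rcases hMp.isLowerUnder_or_compl hNp hMN hM' hN' with h1 | h1 <;>
      rcases hMq.isLowerUnder_or_compl hNq hMN hM' hN' with h2 | h2
    · exact Or.inl fun x y => lt_of_lt_of_common_isLowerUnder hq hF h1 h2 hM.nonempty hM'
    · refine Or.inr fun x y => lt_of_lt_of_common_isLowerUnder hq' hF' h1 ?_ hM.nonempty hM'
      exact fun u v huv hv => by_contra fun hu => h2 huv hu hv
    · refine Or.inr fun x y => lt_of_lt_of_common_isLowerUnder hq' hF' h1 ?_ hMc hMc'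
      exact fun u v huv hv hu => hv (h2 huv hu)
    · exact Or.inl fun x y => lt_of_lt_of_common_isLowerUnder hq hF h1 h2 hMc hMc'
  · by_contra! hcon
    obtain ⟨⟨x, y, hxy, hqxy⟩, z, w, hzw, hqzw⟩ := hcon
    have hne : x ≠ y := fun h => hxy.ne (congrArg p h)
    have huniv : ({x, y} : Set X) ≠ Set.univ := by
      intro h
      have hz : z ∈ ({x, y} : Set X) := h ▸ Set.mem_univ z
      have hw : w ∈ ({x, y} : Set X) := h ▸ Set.mem_univ w
      rcases hz with rfl | rfl <;> rcases hw with rfl | rfl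
      · exact hzw.ne rfl
      · exact hne (hq (le_antisymm hqzw hqxy))
      · exact lt_asymm hxy hzw
      · exact hzw.ne rfl
    obtain ⟨N, hNp, hNq, ⟨a, haN, haB⟩, ⟨b, hbN, hbB⟩, ⟨c, -, hcN⟩⟩ :=
      hF {x, y} ⟨x, by simp, y, by simp, hne⟩ huniv
    exact hR ⟨N, hNp, hNq, ⟨a, haN, b, hbN, fun h => hbB (h ▸ haB)⟩,
      fun h => hcN (h ▸ Set.mem_univ c)⟩

end CommonIntervals

section CliquePaths

variable {V : Type*} {G : SimpleGraph V} {ℓ ℓ' : ℕ} {K : Fin ℓ → Finset V}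

theorem Maximal.exists_not_adj_of_notMem {s : Set V} (hs : Maximal G.IsClique s) {u : V}
    (hu : u ∉ s) : ∃ w ∈ s, ¬ G.Adj u w := by
  by_contra! h
  exact hu (hs.2 (hs.1.insert fun w hw _ => h w hw) (Set.subset_insert u s)
    (Set.mem_insert u s))

namespace IsCliquePath

theorem not_subset (hK : IsCliquePath G K) {i j : Fin ℓ} (hij : i ≠ j) :
    ∃ u ∈ K i, u ∉ K j := by
  by_contra! h
  exact hij (hK.injective (Finset.coe_injective
    (Set.Subset.antisymm h ((hK.maxClique i).2 (hK.maxClique j).1 h))))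

theorem exists_mem_mem_of_adj [Finite V] (hK : IsCliquePath G K) {u v : V} (h : G.Adj u v) :
    ∃ i, u ∈ K i ∧ v ∈ K i := by
  have huv : G.IsClique ({u, v} : Set V) := isClique_pair.2 fun _ => h
  obtain ⟨s, hs, hmax⟩ := Finite.exists_le_maximal huv
  obtain ⟨i, rfl⟩ := hK.complete s hmax
  exact ⟨i, hs (by simp), hs (by simp)⟩

/-- If all proper modules consist of true twins, then each nontrivial set of maximal cliques is
overlapped by the set of maximal cliques containing some vertex. -/
theorem exists_overlap [Finite V]
    (hmod : ∀ M : Set V, IsGraphModule G M → M ≠ Set.univ →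
      ∀ u ∈ M, ∀ v ∈ M, u ≠ v → AreTrueTwins G u v)
    (hK : IsCliquePath G K) {B : Set (Fin ℓ)} (hB : B.Nontrivial) (hB' : B ≠ Set.univ) :
    ∃ v, Overlap {i | v ∈ K i} B := by
  by_contra! hcon
  have hover : ∀ v i j k, i ∈ B → j ∈ B → k ∉ B → v ∈ K i → v ∈ K k → v ∈ K j :=
    fun v i j k hi hj hk hvi hvk => by_contra fun hvj =>
      hcon v ⟨⟨i, hvi, hi⟩, ⟨k, hvk, hk⟩, ⟨j, hj, hvj⟩⟩
  let M : Set V := {v | ∀ i, v ∈ K i → i ∈ B}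
  have hM : IsGraphModule G M := by
    intro x hx
    obtain ⟨k, hxk, hk⟩ : ∃ k, x ∈ K k ∧ k ∉ B := by simpa [M] using hx
    by_cases h : ∃ i ∈ B, x ∈ K i
    · obtain ⟨i, hi, hxi⟩ := h
      refine Or.inl fun v hv => ?_
      obtain ⟨j, hvj⟩ := hK.covers v
      exact (hK.maxClique j).1 (hover x i j k hi (hv j hvj) hk hxi hxk) hvj
        fun h => hx (h ▸ hv)
    · refine Or.inr fun v hv hxv => ?_
      obtain ⟨i, hxi, hvi⟩ := hK.exists_mem_mem_of_adj hxv
      exact h ⟨i, hv i hvi, hxi⟩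
  obtain ⟨i, hi, j, hj, hij⟩ := hB
  have hmem : ∀ {i j u}, i ∈ B → j ∈ B → u ∈ K i → u ∉ K j → u ∈ M :=
    fun {i j u} hi hj hui huj k huk => by_contra fun hk => huj (hover u i j k hi hj hk hui huk)
  obtain ⟨u, hui, huj⟩ := hK.not_subset hij
  obtain ⟨w, hwj, huw⟩ := (hK.maxClique j).exists_not_adj_of_notMem (u := u) (by simpa using huj)
  have hne : u ≠ w := fun h => huj (h ▸ hwj)
  have hwi : w ∉ K i := fun hwi => huw ((hK.maxClique i).1 hui hwi hne)
  have hM' : M ≠ Set.univ := by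
    obtain ⟨k, hk⟩ := (Set.ne_univ_iff_exists_notMem B).1 hB'
    obtain ⟨v, hvk, -⟩ := hK.not_subset (i := k) (j := i) fun h => hk (h ▸ hi)
    exact fun h => hk ((h ▸ Set.mem_univ v : v ∈ M) k hvk)
  exact huw (hmod M hM hM' u (hmem hi hj hui huj) w (hmem hj hi hwj hwi) hne).1

theorem exists_equiv {K' : Fin ℓ' → Finset V} (hK : IsCliquePath G K)
    (hK' : IsCliquePath G K') : ∃ e : Fin ℓ ≃ Fin ℓ', ∀ i, K' (e i) = K i := by
  have h : ∀ i, ∃ j, K' j = K i := fun i =>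
    let ⟨j, hj⟩ := hK'.complete _ (hK.maxClique i); ⟨j, Finset.coe_injective hj⟩
  choose f hf using h
  refine ⟨Equiv.ofBijective f ⟨fun i j hij => hK.injective ?_, fun j => ?_⟩, hf⟩
  · rw [← hf i, ← hf j, hij]
  · obtain ⟨i, hi⟩ := hK.complete _ (hK'.maxClique j)
    exact ⟨i, hK'.injective ((hf i).trans (Finset.coe_injective hi))⟩

end IsCliquePath

end CliquePaths

/-- if every nontrivial module of an interval graph is a set of pairwise
true twins, then its clique path is unique up to full reversal. -/
theorem clique_path_unique_of_modules_true_twins {V : Type*} [Finite V]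
    (G : SimpleGraph V) (hG : IsIntervalGraph G)
    (hmod : ∀ M : Set V, IsGraphModule G M → M ≠ Set.univ →
      ∀ u ∈ M, ∀ v ∈ M, u ≠ v → AreTrueTwins G u v)
    {ℓ ℓ' : ℕ} (K : Fin ℓ → Finset V) (K' : Fin ℓ' → Finset V)
    (hK : IsCliquePath G K) (hK' : IsCliquePath G K') :
    ∃ h : ℓ' = ℓ,
      (∀ i : Fin ℓ', K' i = K (Fin.cast h i)) ∨
      (∀ i : Fin ℓ', K' i = K (Fin.cast h i).rev) := by
  obtain ⟨e, he⟩ := hK.exists_equiv hK'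
  obtain rfl : ℓ = ℓ' := by simpa using Fintype.card_congr e
  have hF : ∀ B : Set (Fin ℓ), B.Nontrivial → B ≠ Set.univ →
      ∃ J, IsConvexUnder id J ∧ IsConvexUnder e J ∧ Overlap J B := by
    intro B hB hB'
    obtain ⟨v, hv⟩ := hK.exists_overlap hmod hB hB'
    refine ⟨_, fun i j k hij hjk hi hk => hK.consecutive v i j k hij hjk hi hk,
      fun i j k hij hjk hi hk => ?_, hv⟩
    have := hK'.consecutive v (e i) (e j) (e k) hij hjk
    rw [he, he, he] at this
    exact this hi hk
  have eq_id : ∀ f : Fin ℓ ≃ Fin ℓ, (∀ i j, i < j → f i < f j) → ∀ i, f i = i := by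
    intro f hf i
    have hf' : StrictMono f := fun i j => hf i j
    exact DFunLike.congr_fun
      (Subsingleton.elim (hf'.orderIsoOfSurjective f f.surjective) (OrderIso.refl _)) i
  refine ⟨rfl, ?_⟩
  rcases lt_imp_lt_or_lt_imp_gt_of_overlap e.injective hF with h | h
  · refine Or.inl fun i => ?_
    conv_lhs => rw [← eq_id e h i]
    exact he i
  · refine Or.inr fun i => ?_
    have hrev := eq_id (e.trans Fin.revPerm) fun i j hij => Fin.rev_lt_rev.2 (h i j hij)
    have hi : e i.rev = i := Fin.rev_injective (hrev i.rev)
    conv_lhs => rw [← hi]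
    exact he i.rev
end

section
/- Let π be a well-anchored LBFS ordering of an interval graph G and let π⁺ = LBFS⁺(G, π). Let S be a snapshot of π⁺ (i.e., S = S_{π⁺}(x) for some vertex x) that is not a clique. If the π-smallest vertex of S is not exposed from S in π⁺, then S is a module of G. -/
open SimpleGraph

section Helpers

variable {V : Type*}

theorem IsIntervalGraph.exists_endpoints {G : SimpleGraph V} (hG : IsIntervalGraph G) :
    ∃ lo hi : V → ℝ, (∀ v, lo v ≤ hi v) ∧
      ∀ u v, u ≠ v → (G.Adj u v ↔ lo u ≤ hi v ∧ lo v ≤ hi u) := by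
  obtain ⟨I, hI, hadj⟩ := hG
  choose lo hi hle hIcc using hI
  refine ⟨lo, hi, hle, fun u v huv => ?_⟩
  rw [hadj u v huv, hIcc, hIcc, Set.Icc_inter_Icc, Set.nonempty_Icc]
  have := hle u
  have := hle v
  simp only [sup_le_iff, le_inf_iff]
  tauto

theorem IsIntervalGraph.induce {G : SimpleGraph V} (hG : IsIntervalGraph G) (T : Set V) :
    IsIntervalGraph (G.induce T) := by
  obtain ⟨I, hI, hadj⟩ := hG
  exact ⟨fun v => I v, fun v => hI v, fun u v huv =>
    hadj u v (fun h => huv (Subtype.ext h))⟩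

/-- Two vertices with two common nonadjacent neighbors are adjacent in an interval graph. -/
theorem IsIntervalGraph.adj_of_common_nonadj {G : SimpleGraph V} (hG : IsIntervalGraph G)
    {s t m n : V} (hst : s ≠ t) (hnst : ¬ G.Adj s t) (hmn : m ≠ n)
    (hms : G.Adj m s) (hmt : G.Adj m t) (hns : G.Adj n s) (hnt : G.Adj n t) : G.Adj m n := by
  obtain ⟨lo, hi, hle, hadj⟩ := hG.exists_endpoints
  rw [hadj _ _ hmn]
  rw [hadj _ _ hst] at hnst
  rw [hadj _ _ hms.ne] at hms
  rw [hadj _ _ hmt.ne] at hmt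
  rw [hadj _ _ hns.ne] at hns
  rw [hadj _ _ hnt.ne] at hnt
  have := hle s
  have := hle t
  rw [not_and_or, not_le, not_le] at hnst
  rcases hnst with h | h <;> constructor <;> linarith

/-- Adjacency in `G` with the closed neighborhood of `v` removed. -/
def AwayAdj (G : SimpleGraph V) (v a b : V) : Prop :=
  G.Adj a b ∧ (a ≠ v ∧ ¬ G.Adj v a) ∧ (b ≠ v ∧ ¬ G.Adj v b)

theorem AwayAdj.symm {G : SimpleGraph V} {v a b : V} (h : AwayAdj G v a b) :
    AwayAdj G v b a := ⟨h.1.symm, h.2.2, h.2.1⟩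

/-- Reachability in `G` with the closed neighborhood of `v` removed. -/
abbrev AwayReach (G : SimpleGraph V) (v : V) : V → V → Prop :=
  Relation.ReflTransGen (AwayAdj G v)

theorem AwayReach.symm {G : SimpleGraph V} {v a b : V} (h : AwayReach G v a b) :
    AwayReach G v b a := by
  induction h with
  | refl => exact .refl
  | tail _ hbc ih => exact .head hbc.symm ih

theorem AwayReach.right_away {G : SimpleGraph V} {v a b : V} (h : AwayReach G v a b)
    (ha : a ≠ v ∧ ¬ G.Adj v a) : b ≠ v ∧ ¬ G.Adj v b := by
  cases h with
  | refl => exact ha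
  | tail _ hbc => exact hbc.2.2

/-- A connected set avoiding the closed neighborhood of `v` lies on one side of `v`. -/
theorem AwayReach.same_side {G : SimpleGraph V} {v a b : V} {lo hi : V → ℝ}
    (hle : ∀ v, lo v ≤ hi v)
    (hadj : ∀ u v, u ≠ v → (G.Adj u v ↔ lo u ≤ hi v ∧ lo v ≤ hi u))
    (ha : a ≠ v ∧ ¬ G.Adj v a) (h : AwayReach G v a b) :
    (hi a < lo v ∧ hi b < lo v) ∨ (hi v < lo a ∧ hi v < lo b) := by
  have side : ∀ c, c ≠ v ∧ ¬ G.Adj v c → hi c < lo v ∨ hi v < lo c := by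
    rintro c ⟨hc, hvc⟩
    rw [hadj _ _ hc.symm, not_and_or, not_le, not_le] at hvc
    exact hvc
  induction h with
  | refl => have := side a ha; tauto
  | @tail b c _ hbc ih =>
    have hc := side c hbc.2.2
    have hbc' := (hadj _ _ hbc.1.ne).1 hbc.1
    have := hle v
    rcases ih with ⟨h1, h2⟩ | ⟨h1, h2⟩
    · left
      refine ⟨h1, hc.resolve_right fun h => ?_⟩
      linarith
    · right
      refine ⟨h1, hc.resolve_left fun h => ?_⟩
      linarith

section LastVertex

variable {G : SimpleGraph V} {σ : V ≃ Fin (Nat.card V)} {v : V}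

theorem exists_away_of_nonadj (hσ : IsLBFSOrdering G σ) (hlast : ∀ u, σ u ≤ σ v) {p c : V}
    (hc : c ≠ v ∧ ¬ G.Adj v c) (hpv : G.Adj v p) (hpc : ¬ G.Adj p c) :
    ∃ f, σ f < σ p ∧ AwayReach G v c f ∧ (f = c ∨ AwayAdj G v f c) := by
  have hcv : σ c < σ v := lt_of_le_of_ne (hlast c) (fun h => hc.1 (σ.injective h))
  have hne : p ≠ c := by rintro rfl; exact hc.2 hpv
  rcases lt_or_gt_of_ne (fun h => hne (σ.injective h)) with h | h
  · obtain ⟨f, hf, hfc, hfv⟩ := hσ p c v h hcv hpv.symm hpc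
    have hfne : f ≠ v := by
      rintro rfl
      exact absurd (hf.trans (h.trans hcv)) (lt_irrefl _)
    have hcf : AwayAdj G v f c := ⟨hfc, ⟨hfne, fun h => hfv h.symm⟩, hc⟩
    exact ⟨f, hf, .single hcf.symm, .inr hcf⟩
  · exact ⟨c, h, .refl, .inl rfl⟩

/-- If `c` precedes a root `u` of `G - N[v]` and `p` is a neighbor of `c` after `u`, then
some neighbor of `v` before `p` is not adjacent to `p`. -/
theorem exists_nbr_missing (hσ : IsLBFSOrdering G σ) (hlast : ∀ u, σ u ≤ σ v) {c u p : V}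
    (hroot : ∀ b, AwayAdj G v b u → σ u ≤ σ b) (hu : u ≠ v ∧ ¬ G.Adj v u)
    (hc : c ≠ v ∧ ¬ G.Adj v c) (hcu : σ c < σ u) (hup : σ u < σ p) (hcp : G.Adj c p) :
    ∃ e, σ e < σ p ∧ G.Adj v e ∧ ¬ G.Adj e p := by
  have hncu : ¬ G.Adj c u := fun h => absurd (hroot c ⟨h, hc, hu⟩) (not_le.2 hcu)
  obtain ⟨e, he, heu, hep⟩ := hσ c u p hcu hup hcp hncu
  have hne : e ≠ v := by
    rintro rfl
    exact absurd (hlast c) (not_le.2 he)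
  refine ⟨e, he.trans (hcu.trans hup), ?_, hep⟩
  by_contra hev
  exact absurd (hroot e ⟨heu, ⟨hne, hev⟩, hu⟩) (not_le.2 (he.trans hcu))

variable [Finite V]

theorem exists_order_min (σ : V ≃ Fin (Nat.card V)) {P : V → Prop} (h : ∃ a, P a) :
    ∃ a, P a ∧ ∀ b, P b → σ a ≤ σ b := by
  obtain ⟨a, ha, hmin⟩ := Set.exists_min_image {a | P a} σ (Set.toFinite _) h
  exact ⟨a, ha, hmin⟩

/-- A vertex without earlier neighbors away from `v` is not jumped over by an edge
away from `v`. -/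
theorem not_crossing_root (hσ : IsLBFSOrdering G σ) (hlast : ∀ u, σ u ≤ σ v) {u l l' : V}
    (hroot : ∀ b, AwayAdj G v b u → σ u ≤ σ b) (hu : u ≠ v ∧ ¬ G.Adj v u)
    (hl : AwayAdj G v l' l) (h1 : σ l' < σ u) (h2 : σ u < σ l) : False := by
  obtain ⟨m, hm, hmin⟩ := exists_order_min σ (P := fun m => AwayAdj G v m l) ⟨l', hl⟩
  have hmu : σ m < σ u := (hmin l' hl).trans_lt h1
  have hnmu : ¬ G.Adj m u := fun h => absurd (hroot m ⟨h, hm.2.1, hu⟩) (not_le.2 hmu)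
  obtain ⟨e, he, heu, hel⟩ := hσ m u l hmu h2 hm.1 hnmu
  have hev : G.Adj v e := by
    by_contra hev
    have hne : e ≠ v := by
      rintro rfl
      exact absurd (hlast m) (not_le.2 he)
    exact absurd (hroot e ⟨heu, ⟨hne, hev⟩, hu⟩) (not_le.2 (he.trans hmu))
  obtain ⟨f, hf, -, rfl | hfl⟩ := exists_away_of_nonadj hσ hlast hl.2.2 hev hel
  · exact absurd (hf.trans (he.trans (hmu.trans h2))) (lt_irrefl _)
  · exact absurd (hmin f hfl) (not_le.2 (hf.trans he))

theorem AwayReach.lt_root (hσ : IsLBFSOrdering G σ) (hlast : ∀ u, σ u ≤ σ v) {u c c' : V}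
    (hroot : ∀ b, AwayAdj G v b u → σ u ≤ σ b) (hu : u ≠ v ∧ ¬ G.Adj v u)
    (h : AwayReach G v c c') (hc : σ c < σ u) : σ c' < σ u := by
  induction h with
  | refl => exact hc
  | @tail b d _ hbd ih =>
    rcases lt_trichotomy (σ d) (σ u) with h | h | h
    · exact h
    · obtain rfl := σ.injective h
      exact absurd (hroot b hbd) (not_le.2 ih)
    · exact (not_crossing_root hσ hlast hroot hu hbd ih h).elim

theorem exists_root {y : V} (hy : y ≠ v ∧ ¬ G.Adj v y) (σ : V ≃ Fin (Nat.card V)) :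
    ∃ u, AwayReach G v y u ∧ (u ≠ v ∧ ¬ G.Adj v u) ∧
      (∀ c, AwayReach G v y c → σ u ≤ σ c) ∧ ∀ b, AwayAdj G v b u → σ u ≤ σ b := by
  obtain ⟨u, hu, hmin⟩ := exists_order_min σ (P := AwayReach G v y) ⟨y, .refl⟩
  exact ⟨u, hu, hu.right_away hy, hmin, fun b hb => hmin b (hu.tail hb.symm)⟩

/-- The neighbors of the last vertex of an LBFS ordering of an interval graph form a
clique. -/
theorem nbrs_of_last_adj (hG : IsIntervalGraph G) (hσ : IsLBFSOrdering G σ)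
    (hlast : ∀ u, σ u ≤ σ v) {p q : V} (hp : G.Adj v p) (hq : G.Adj v q) (hpq : p ≠ q) :
    G.Adj p q := by
  by_contra hnpq
  obtain ⟨lo, hi, hle, hadj⟩ := hG.exists_endpoints
  obtain ⟨p, ⟨hp, q, hq, hpq, hnpq⟩, hmin⟩ := exists_order_min σ
    (P := fun p => G.Adj v p ∧ ∃ q, G.Adj v q ∧ p ≠ q ∧ ¬ G.Adj p q) ⟨p, hp, q, hq, hpq, hnpq⟩
  have hlt : σ p < σ q :=
    lt_of_le_of_ne (hmin q ⟨hq, p, hp, hpq.symm, fun h => hnpq h.symm⟩)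
      (fun h => hpq (σ.injective h))
  have hqv : σ q < σ v := lt_of_le_of_ne (hlast q) (fun h => hq.ne (σ.injective h).symm)
  obtain ⟨e₂, he₂, he₂q, he₂v⟩ := hσ p q v hlt hqv hp.symm hnpq
  have hv₂ : e₂ ≠ v := by
    rintro rfl
    exact absurd (hlast p) (not_le.2 he₂)
  have ha₂ : e₂ ≠ v ∧ ¬ G.Adj v e₂ := ⟨hv₂, fun h => he₂v h.symm⟩
  have he₂p : ¬ G.Adj e₂ p := fun h =>
    hnpq (hG.adj_of_common_nonadj hv₂ he₂v hpq h.symm hp.symm he₂q.symm hq.symm)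
  obtain ⟨e₁, he₁, he₁p, he₁q⟩ := hσ e₂ p q he₂ hlt he₂q he₂p
  have hv₁ : e₁ ≠ v := by
    rintro rfl
    exact absurd (hlast e₂) (not_le.2 he₁)
  have he₁q' : e₁ ≠ q := by
    rintro rfl
    exact absurd (he₁.trans (he₂.trans hlt)) (lt_irrefl _)
  have ha₁ : e₁ ≠ v ∧ ¬ G.Adj v e₁ := ⟨hv₁, fun h =>
    absurd (hmin e₁ ⟨h, q, hq, he₁q', he₁q⟩) (not_le.2 (he₁.trans he₂))⟩
  obtain ⟨u, hu, hua, humin, hroot⟩ := exists_root ha₂ σ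
  have hsep : ¬ AwayReach G v e₂ e₁ := by
    intro h
    rw [hadj _ _ hpq, not_and_or, not_le, not_le] at hnpq
    have h1 := (hadj _ _ hp.ne).1 hp
    have h2 := (hadj _ _ hq.ne).1 hq
    have h3 := (hadj _ _ he₂q.ne).1 he₂q
    have h4 := (hadj _ _ he₁p.ne).1 he₁p
    rcases h.same_side hle hadj ha₂ with h | h <;> rcases hnpq with h' | h' <;> linarith
  have hlt' : σ e₁ < σ u := by
    by_contra! hge
    rcases hge.lt_or_eq with hge | hge
    · obtain ⟨u₁, hu₁, hu₁a, hu₁min, hroot₁⟩ := exists_root ha₁ σ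
      rcases lt_trichotomy (σ u) (σ u₁) with h | h | h
      · have := hu.symm.lt_root hσ hlast hroot₁ hu₁a h
        exact absurd (this.trans_le (hu₁min e₁ .refl)) (not_lt.2 he₁.le)
      · obtain rfl := σ.injective h
        exact hsep (hu.trans hu₁.symm)
      · exact absurd (hu₁.symm.lt_root hσ hlast hroot hua h) (not_lt.2 hge.le)
    · obtain rfl := σ.injective hge
      exact hsep hu
  obtain ⟨e, hep, hve, hnep⟩ := exists_nbr_missing hσ hlast hroot hua ha₁ hlt'
    ((humin e₂ .refl).trans_lt he₂) he₁p
  exact absurd (hmin e ⟨hve, p, hp, fun h => hep.ne (congrArg σ h), hnep⟩) (not_le.2 hep)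

/-- Two components of `G - N[v]`, for `v` last in an LBFS ordering of an interval graph:
it is impossible that each of them is seen by a neighbor of `v` that misses a vertex of
the other one. -/
theorem last_not_between (hG : IsIntervalGraph G) (hσ : IsLBFSOrdering G σ)
    (hlast : ∀ u, σ u ≤ σ v) {c d c' d' p q : V}
    (hc : c ≠ v ∧ ¬ G.Adj v c) (hd : d ≠ v ∧ ¬ G.Adj v d)
    (hcc : AwayReach G v c c') (hdd : AwayReach G v d d') (hsep : ¬ AwayReach G v c d)
    (hp : G.Adj v p) (hpc : G.Adj p c) (hpd : ¬ G.Adj p d')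
    (hq : G.Adj v q) (hqd : G.Adj q d) (hqc : ¬ G.Adj q c') : False := by
  have key : ∀ {c d d' p u u' : V}, (c ≠ v ∧ ¬ G.Adj v c) → (d ≠ v ∧ ¬ G.Adj v d) →
      AwayReach G v d d' → G.Adj v p → G.Adj p c → ¬ G.Adj p d' →
      AwayReach G v c u' → σ u' < σ u → (u ≠ v ∧ ¬ G.Adj v u) →
      (∀ b, AwayReach G v d b → σ u ≤ σ b) → (∀ b, AwayAdj G v b u → σ u ≤ σ b) → False := by
    intro c d d' p u u' hc hd hdd hp hpc hpd hcu hlt hu humin hroot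
    obtain ⟨f, hf, hdf, -⟩ := exists_away_of_nonadj hσ hlast (hdd.right_away hd) hp hpd
    have hup : σ u < σ p := (humin f (hdd.trans hdf)).trans_lt hf
    obtain ⟨e, hep, hve, hnep⟩ := exists_nbr_missing hσ hlast hroot hu hc
      (hcu.symm.lt_root hσ hlast hroot hu hlt) hup hpc.symm
    exact hnep (nbrs_of_last_adj hG hσ hlast hve hp (fun h => hep.ne (congrArg σ h)))
  obtain ⟨u, hu, hua, humin, hroot⟩ := exists_root hc σ
  obtain ⟨w, hw, hwa, hwmin, hwroot⟩ := exists_root hd σ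
  rcases lt_trichotomy (σ u) (σ w) with h | h | h
  · exact key hc hd hdd hp hpc hpd hu h hwa hwmin hwroot
  · obtain rfl := σ.injective h
    exact hsep (hu.trans hw.symm)
  · exact key hd hc hcc hq hqd hqc hw h hua humin hroot

end LastVertex

section EndVertex

variable [Finite V] {G : SimpleGraph V} {v : V}

/-- An end vertex `v` of an interval graph is not between nonadjacent `y₁` and `y₂` on a
path `y₁ - p - v - q - y₂` with `p` missing `y₂` and `q` missing `y₁`. -/
theorem IsEndVertex.not_between_short (hG : IsIntervalGraph G) (hv : IsEndVertex G v)
    {y₁ y₂ p q : V} (h1v : ¬ G.Adj v y₁) (h2v : ¬ G.Adj v y₂) (h12 : ¬ G.Adj y₁ y₂)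
    (hp : G.Adj v p) (hp1 : G.Adj p y₁) (hp2 : ¬ G.Adj p y₂)
    (hq : G.Adj v q) (hq2 : G.Adj q y₂) (hq1 : ¬ G.Adj q y₁) : False := by
  obtain ⟨σ, hσ, hlast⟩ := hv
  have h1 : y₁ ≠ v := by rintro rfl; exact hq1 hq.symm
  have h2 : y₂ ≠ v := by rintro rfl; exact hp2 hp.symm
  have hne : y₁ ≠ y₂ := by rintro rfl; exact hq1 hq2
  refine last_not_between hG hσ hlast ⟨h1, h1v⟩ ⟨h2, h2v⟩ .refl .refl ?_ hp hp1 hp2 hq hq2 hq1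
  intro h
  obtain ⟨lo, hi, hle, hadj⟩ := hG.exists_endpoints
  have hpne : p ≠ y₂ := by rintro rfl; exact h2v hp
  have hqne : q ≠ y₁ := by rintro rfl; exact h1v hq
  rw [hadj _ _ hne, not_and_or, not_le, not_le] at h12
  rw [hadj _ _ hpne, not_and_or, not_le, not_le] at hp2
  rw [hadj _ _ hqne, not_and_or, not_le, not_le] at hq1
  have a1 := (hadj _ _ hp.ne).1 hp
  have a2 := (hadj _ _ hq.ne).1 hq
  have a3 := (hadj _ _ hp1.ne).1 hp1
  have a4 := (hadj _ _ hq2.ne).1 hq2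
  have := hle y₁
  have := hle y₂
  rcases h.same_side hle hadj ⟨h1, h1v⟩ with h | h <;> rcases h12 with h' | h' <;>
    rcases hp2 with h'' | h'' <;> rcases hq1 with h3 | h3 <;> linarith

/-- An end vertex `v` of an interval graph is not the short leg of a spider with center `a`
and two long legs `d, f` and `w, z`. -/
theorem IsEndVertex.not_between_long (hG : IsIntervalGraph G) (hv : IsEndVertex G v)
    {f d a w z : V} (hfd : G.Adj f d) (hda : G.Adj d a) (hav : G.Adj v a)
    (hzw : G.Adj z w) (hwa : G.Adj w a) (hvf : ¬ G.Adj v f) (hvd : ¬ G.Adj v d)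
    (hvw : ¬ G.Adj v w) (hvz : ¬ G.Adj v z) (hfa : ¬ G.Adj f a) (hfw : ¬ G.Adj f w)
    (hfz : ¬ G.Adj f z) (hza : ¬ G.Adj z a) (hzd : ¬ G.Adj z d) : False := by
  obtain ⟨σ, hσ, hlast⟩ := hv
  have hd : d ≠ v := by rintro rfl; exact hvf hfd.symm
  have hf : f ≠ v := by rintro rfl; exact hvd hfd
  have hw : w ≠ v := by rintro rfl; exact hvz hzw.symm
  have hz : z ≠ v := by rintro rfl; exact hvw hzw
  have hfz' : f ≠ z := by rintro rfl; exact hfw hzw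
  have hfa' : f ≠ a := by rintro rfl; exact hvf hav
  have hza' : z ≠ a := by rintro rfl; exact hvz hav
  have hfw' : f ≠ w := by rintro rfl; exact hfa hwa
  have hzd' : z ≠ d := by rintro rfl; exact hfz hfd
  refine last_not_between hG hσ hlast (c := d) (d := w) (c' := f) (d' := z) (p := a) (q := a)
    ⟨hd, hvd⟩ ⟨hw, hvw⟩ (.single ⟨hfd.symm, ⟨hd, hvd⟩, hf, hvf⟩)
    (.single ⟨hzw.symm, ⟨hw, hvw⟩, hz, hvz⟩) ?_ hav hda.symm (fun h => hza h.symm)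
    hav hwa.symm (fun h => hfa h.symm)
  intro h
  obtain ⟨lo, hi, hle, hadj⟩ := hG.exists_endpoints
  have s1 := h.same_side hle hadj ⟨hd, hvd⟩
  have s2 := AwayReach.same_side hle hadj ⟨hd, hvd⟩
    (.single (⟨hfd.symm, ⟨hd, hvd⟩, hf, hvf⟩ : AwayAdj G v d f))
  have s3 := AwayReach.same_side hle hadj ⟨hw, hvw⟩
    (.single (⟨hzw.symm, ⟨hw, hvw⟩, hz, hvz⟩ : AwayAdj G v w z))
  rw [hadj _ _ hfz', not_and_or, not_le, not_le] at hfz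
  rw [hadj _ _ hfa', not_and_or, not_le, not_le] at hfa
  rw [hadj _ _ hza', not_and_or, not_le, not_le] at hza
  rw [hadj _ _ hfw', not_and_or, not_le, not_le] at hfw
  rw [hadj _ _ hzd', not_and_or, not_le, not_le] at hzd
  have a1 := (hadj _ _ hfd.ne).1 hfd
  have a2 := (hadj _ _ hda.ne).1 hda
  have a3 := (hadj _ _ hav.ne).1 hav
  have a4 := (hadj _ _ hzw.ne).1 hzw
  have a5 := (hadj _ _ hwa.ne).1 hwa
  have := hle f
  have := hle z
  have := hle v
  have := hle d
  have := hle w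
  rcases s1 with s1 | s1 <;> rcases s2 with s2 | s2 <;> rcases s3 with s3 | s3 <;>
    rcases hfz with h1 | h1 <;> rcases hfa with h2 | h2 <;> rcases hza with h3 | h3 <;>
    rcases hfw with h4 | h4 <;> rcases hzd with h5 | h5 <;> linarith

end EndVertex

end Helpers

/-- for a well-anchored LBFS ordering `π` of an interval graph and
`π⁺ = LBFS⁺(G, π)`, any non-clique snapshot of `π⁺` whose `π`-smallest vertex is not
exposed from it in `π⁺` is a module of `G`. -/
theorem non_exposed_snapshot_is_module {V : Type*} [Finite V]
    (G : SimpleGraph V) (hG : IsIntervalGraph G)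
    (π πp : V ≃ Fin (Nat.card V))
    (hπ : IsWellAnchored G π) (hπp : IsLBFSPlusOf G π πp)
    (x v : V) (hclique : ¬ G.IsClique (snapshot G πp x))
    (hv : v ∈ snapshot G πp x) (hmin : ∀ w ∈ snapshot G πp x, π v ≤ π w)
    (hexp : ¬ ExposedFrom G πp x v) :
    IsGraphModule G (snapshot G πp x) := by
  obtain ⟨hL, hanch⟩ := hπ
  obtain ⟨hLp, hplus⟩ := hπp
  set S := snapshot G πp x
  set N := earlyNbhd G πp x
  have hxS : x ∈ S := ⟨le_rfl, rfl⟩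
  have hSadj : ∀ w ∈ S, ∀ u, πp u < πp x → (G.Adj u w ↔ u ∈ N) := fun w hw u hu =>
    ⟨fun h => hw.2.subset ⟨hu, h⟩, fun h => (hw.2.superset h).2⟩
  have hNlt : ∀ n ∈ N, πp n < πp x := fun n hn => hn.1
  have hNS : ∀ n ∈ N, ∀ w ∈ S, G.Adj n w := fun n hn w hw => (hSadj w hw n hn.1).2 hn
  have hNclique : ∀ n ∈ N, ∀ m ∈ N, n ≠ m → G.Adj n m := by
    rw [SimpleGraph.isClique_iff, Set.Pairwise] at hclique
    push Not at hclique
    obtain ⟨s, hs, t, ht, hst, hnst⟩ := hclique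
    intro n hn m hm hnm
    exact hG.adj_of_common_nonadj hst hnst hnm (hNS n hn s hs) (hNS n hn t ht)
      (hNS m hm s hs) (hNS m hm t ht)
  have hvN : ∀ y, G.Adj v y → y ∈ N ∨ y ∈ S := by
    intro y hy
    by_contra h
    exact hexp ⟨hv, y, hy, h⟩
  have hlate : ∀ z w, z ∉ S → z ∉ N → w ∈ S → G.Adj z w → π v < π z := by
    intro z w hzS hzN hw hzw
    have hzv : ¬ G.Adj z v := fun h => (hvN z h.symm).elim hzN hzS
    by_contra! hle
    have hlt : π z < π v := lt_of_le_of_ne hle (fun h => hzS (π.injective h ▸ hv))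
    have hvw : π v < π w := lt_of_le_of_ne (hmin w hw) (fun h => hzv (π.injective h ▸ hzw))
    obtain ⟨d, hd, hdv, hdw⟩ := hL z v w hlt hvw hzw hzv
    rcases hvN d hdv.symm with h | h
    · exact hdw (hNS d h w hw)
    · exact absurd (hmin d h) (not_le.2 (hd.trans hlt))
  set T := snapshot G π v
  set M := earlyNbhd G π v
  have hTge : ∀ t ∈ T, π v ≤ π t := fun t ht => ht.1
  have hMN : M ⊆ N := fun u hu => (hvN u hu.2.symm).resolve_right
    (fun h => absurd (hmin u h) (not_le.2 hu.1))
  have hST : S ⊆ T := by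
    intro w hw
    refine ⟨hmin w hw, Set.ext fun u => ⟨?_, fun hu => ⟨hu.1, hNS u (hMN hu) w hw⟩⟩⟩
    rintro ⟨huv, huw⟩
    have huS : u ∉ S := fun h => absurd (hmin u h) (not_le.2 huv)
    have huN : u ∈ N := by
      by_contra huN
      exact absurd (hlate u w huS huN hw huw) (not_lt.2 huv.le)
    exact ⟨huv, hNS u huN v hv⟩
  have hvT : v ∈ T := hST hv
  have hTexp : ¬ ∃ t, ExposedFrom G π v t := by
    intro h
    obtain ⟨-, y, hy, hyMT⟩ := (hanch v).1 h
    change G.Adj v y at hy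
    have hyM : y ∉ M := fun h => hyMT (.inl h)
    have hyT : y ∉ T := fun h => hyMT (.inr h)
    have hyN : y ∈ N := (hvN y hy).resolve_right (fun h => hyT (hST h))
    have hvy : π v < π y := by
      by_contra! hle
      exact hyM ⟨lt_of_le_of_ne hle (fun h => hy.ne (π.injective h).symm), hy.symm⟩
    have hMy : ∀ b ∈ M, G.Adj b y := fun b hb => hNclique b (hMN hb) y hyN
      (fun h => absurd (hb.1.trans hvy) (by rw [h]; exact lt_irrefl _))
    refine hyT ⟨hvy.le, Set.ext fun b => ⟨?_, fun hb => ⟨hb.1, hMy b hb⟩⟩⟩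
    rintro ⟨hbv, hby⟩
    by_contra hbM
    obtain ⟨d, hd, hdv, hdy⟩ := hL b v y hbv hvy hby (fun h => hbM ⟨hbv, h⟩)
    exact hdy (hMy d ⟨hd.trans hbv, hdv⟩)
  have hTnbr : ∀ t ∈ T, ∀ y, G.Adj t y → y ∈ M ∨ y ∈ T := by
    intro t ht y hty
    by_contra h
    exact hTexp ⟨t, ht, y, hty, h⟩
  have hMT : ∀ m ∈ M, ∀ t ∈ T, G.Adj m t := fun m hm t ht => (ht.2.superset hm).2
  have hTmod : ∀ g t t', t ∈ T → t' ∈ T → G.Adj g t → ¬ G.Adj g t' → g ∈ T := by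
    intro g t t' ht ht' hgt hgt'
    exact (hTnbr t ht g hgt.symm).resolve_left (fun h => hgt' (hMT g h t' ht'))
  obtain ⟨_, hend⟩ := (hanch v).2 hTexp
  have hGT := hG.induce T
  have hshort : ∀ y₁ ∈ T, ∀ y₂ ∈ T, ∀ p ∈ T, ∀ q ∈ T, ¬ G.Adj v y₁ → ¬ G.Adj v y₂ →
      ¬ G.Adj y₁ y₂ → G.Adj v p → G.Adj p y₁ → ¬ G.Adj p y₂ → G.Adj v q → G.Adj q y₂ →
      ¬ G.Adj q y₁ → False := fun y₁ h₁ y₂ h₂ p hp q hq =>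
    IsEndVertex.not_between_short (G := G.induce T) hGT hend (y₁ := ⟨y₁, h₁⟩) (y₂ := ⟨y₂, h₂⟩)
      (p := ⟨p, hp⟩) (q := ⟨q, hq⟩)
  intro z hzS
  by_contra hz
  push Not at hz
  obtain ⟨⟨w', hw', hzw'⟩, w, hw, hzw⟩ := hz
  have hzN : z ∉ N := fun h => hzw' (hNS z h w' hw')
  have hvz : ¬ G.Adj v z := fun h => (hvN z h).elim hzN hzS
  have hxz : πp x < πp z := by
    by_contra! hle
    have hlt : πp z < πp x := lt_of_le_of_ne hle (fun h => hzS (πp.injective h ▸ hxS))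
    exact hzN ((hSadj w hw z hlt).1 hzw)
  have hwT := hST hw
  have hzT : z ∈ T := (hTnbr w hwT z hzw.symm).resolve_left (fun h => hzN (hMN h))
  have hmiss : ∀ b, πp b < πp x → G.Adj b z → b ∉ N →
      ∃ d, πp d < πp b ∧ d ∈ N ∧ ¬ G.Adj d z := by
    intro b hb hbz hbN
    obtain ⟨d, hd, hdx, hdz⟩ := hLp b x z hb hxz hbz (fun h => hbN ⟨hb, h⟩)
    exact ⟨d, hd, ⟨hd.trans hb, hdx⟩, hdz⟩
  have hex : ∃ a, a ∈ N ∧ ¬ G.Adj a z := by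
    by_contra! hall
    refine hzS ⟨hxz.le, Set.ext fun b => ⟨?_, fun hb => ⟨hb.1, hall b hb⟩⟩⟩
    rintro ⟨hbx, hbz⟩
    by_contra hbN
    obtain ⟨d, -, hd, hdz⟩ := hmiss b hbx hbz hbN
    exact hdz (hall d hd)
  obtain ⟨a, ⟨haN, haz⟩, hamin⟩ := exists_order_min πp hex
  have hax := hNlt a haN
  have hD : ∀ d, πp d < πp a → (G.Adj d z ↔ d ∈ N) := by
    intro d hd
    constructor
    · intro hdz
      by_contra hdN
      obtain ⟨e, he, heN, hez⟩ := hmiss d (hd.trans hax) hdz hdN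
      exact absurd (hamin e ⟨heN, hez⟩) (not_le.2 (he.trans hd))
    · intro hdN
      by_contra hdz
      exact absurd (hamin d ⟨hdN, hdz⟩) (not_le.2 hd)
  have hav := hNS a haN v hv
  have haw := hNS a haN w hw
  have haT : a ∈ T := (hTnbr v hvT a hav.symm).resolve_left (fun h => haz (hMT a h z hzT))
  have hTadj : ∀ e ∈ T, π e < π a → e ≠ v → G.Adj v e := by
    intro e he hea hev
    by_contra hnve
    obtain ⟨g, hg, hge, hga⟩ := hL v e a
      (lt_of_le_of_ne (hTge e he) (fun h => hev (π.injective h).symm)) hea hav.symm hnve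
    exact absurd (hTge g (hTmod g e a he haT hge hga)) (not_le.2 hg)
  have hzv : z ≠ v := fun h => hzS (h ▸ hv)
  have haz' : π a < π z := by
    by_contra! hle
    exact hvz (hTadj z hzT
      (lt_of_le_of_ne hle (fun h => hzN (π.injective h ▸ haN))) hzv)
  have hDa : ∀ d, πp d < πp a → G.Adj d z → G.Adj d a := fun d hd hdz =>
    hNclique d ((hD d hd).1 hdz) a haN (fun h => hd.ne (congrArg πp h))
  by_cases hcase : ∃ d, πp d < πp a ∧ G.Adj d a ∧ ¬ G.Adj d z
  · obtain ⟨d, ⟨hda, hdadj, hdz⟩, hdmin⟩ := exists_order_min πp hcase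
    have hout : ∀ e, πp e < πp a → ¬ G.Adj e z → ∀ s ∈ S, ¬ G.Adj e s :=
      fun e he hez s hs h => hez ((hD e he).2 ((hSadj s hs e (he.trans hax)).1 h))
    have hdv : ¬ G.Adj v d := fun h => hout d hda hdz v hv h.symm
    have hdw := hout d hda hdz w hw
    have hdT : d ∈ T := hTmod d a v haT hvT hdadj (fun h => hdv h.symm)
    have hblock : ∀ q ∈ T, G.Adj v q → G.Adj q z → G.Adj q d := by
      intro q hq hvq hqz
      by_contra hqd
      exact hshort d hdT z hzT a haT q hq hdv hvz hdz hav.symm hdadj.symm haz hvq hqz hqd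
    have hvw : ¬ G.Adj v w := fun h => hdw (hblock w hwT h hzw.symm).symm
    have hdz' : π d < π z := by
      by_contra! hle
      have hlt : π z < π d := lt_of_le_of_ne hle
        (fun h => absurd (hda.trans (hax.trans hxz)) (by rw [π.injective h]; exact lt_irrefl _))
      obtain ⟨e, he, hez, hed⟩ := hL a z d haz' hlt hdadj.symm haz
      have heT := hTmod e z d hzT hdT hez hed
      exact hed (hblock e heT (hTadj e heT he (fun h => hvz (h ▸ hez))) hez)
    refine absurd (hplus d z ⟨(hda.trans (hax.trans hxz)).le, Set.ext fun f => ?_⟩)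
      (not_le.2 hdz')
    refine ⟨fun ⟨hf, hfz⟩ => ⟨hf, ?_⟩, fun ⟨hf, hfd⟩ => ⟨hf, ?_⟩⟩
    · by_contra hfd
      have hfT := hTmod f z d hzT hdT hfz hfd
      exact hfd (hblock f hfT (hNS f ((hD f (hf.trans hda)).1 hfz) v hv).symm hfz)
    · by_contra hfz
      have hfS := hout f (hf.trans hda) hfz
      have hfT := hTmod f d z hdT hzT hfd hfz
      have hfa : ¬ G.Adj f a := fun h =>
        absurd (hdmin f ⟨hf.trans hda, h, hfz⟩) (not_le.2 hf)
      exact IsEndVertex.not_between_long (G := G.induce T) hGT hend (f := ⟨f, hfT⟩)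
        (d := ⟨d, hdT⟩) (a := ⟨a, haT⟩) (w := ⟨w, hwT⟩) (z := ⟨z, hzT⟩) hfd hdadj hav.symm
        hzw haw.symm (fun h => hfS v hv h.symm) hdv hvw hvz hfa (hfS w hw) hfz
        (fun h => haz h.symm) (fun h => hdz h.symm)
  · push Not at hcase
    refine absurd (hplus a z ⟨(hax.trans hxz).le, Set.ext fun d => ?_⟩) (not_le.2 haz')
    exact ⟨fun ⟨hd, hdz⟩ => ⟨hd, hDa d hd hdz⟩, fun ⟨hd, hda⟩ => ⟨hd, hcase d hd hda⟩⟩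
end

section
/- Let π be a well-anchored LBFS ordering of an interval graph G, let π⁺ = LBFS⁺(G, π), and let M be a module of G. Then the sub-ordering π|_M is a well-anchored LBFS ordering of the induced subgraph G[M], and π⁺|_M = LBFS⁺(G[M], π|_M). -/
open SimpleGraph

/-- Every injective ranking of a finite type is realized by an ordering. -/
lemma exists_ordering_of_injective {W : Type*} [Finite W] (f : W → ℕ)
    (hf : Function.Injective f) :
    ∃ σ : W ≃ Fin (Nat.card W), ∀ u v, σ u < σ v ↔ f u < f v := by
  classical
  have := Fintype.ofFinite W
  let _ : LinearOrder W := LinearOrder.lift' f hf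
  let e : W ≃o Fin (Nat.card W) :=
    (Fintype.orderIsoFinOfCardEq W Nat.card_eq_fintype_card.symm).symm
  exact ⟨e.toEquiv, fun u v => e.lt_iff_lt⟩

/-- An LBFS ordering restricts to an LBFS ordering of the subgraph induced by a module. -/
lemma IsLBFSOrdering.restrict {V W : Type*} [Finite V] [Finite W]
    {G : SimpleGraph V} {H : SimpleGraph W} (φ : H ↪g G)
    (hφ : IsGraphModule G (Set.range φ))
    {σ : V ≃ Fin (Nat.card V)} {τ : W ≃ Fin (Nat.card W)}
    (hτ : ∀ u v, τ u < τ v ↔ σ (φ u) < σ (φ v)) (hσ : IsLBFSOrdering G σ) :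
    IsLBFSOrdering H τ := by
  intro a b c hab hbc hac hnab
  obtain ⟨d, hda, hdb, hdc⟩ := hσ (φ a) (φ b) (φ c) ((hτ _ _).1 hab) ((hτ _ _).1 hbc)
    (φ.map_adj_iff.2 hac) (fun h => hnab (φ.map_adj_iff.1 h))
  by_cases hd : d ∈ Set.range φ
  · obtain ⟨d, rfl⟩ := hd
    exact ⟨d, (hτ _ _).2 hda, φ.map_adj_iff.1 hdb, fun h => hdc (φ.map_adj_iff.2 h)⟩
  · rcases hφ d hd with h | h
    · exact absurd (h _ ⟨c, rfl⟩) hdc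
    · exact absurd hdb (h _ ⟨b, rfl⟩)

/-- An end vertex lying in a module is an end vertex of the subgraph induced by the module. -/
lemma IsEndVertex.restrict {V W : Type*} [Finite V] [Finite W]
    {G : SimpleGraph V} {H : SimpleGraph W} (φ : H ↪g G)
    (hφ : IsGraphModule G (Set.range φ)) {x : W} (hx : IsEndVertex G (φ x)) :
    IsEndVertex H x := by
  obtain ⟨σ, hσ, hlast⟩ := hx
  obtain ⟨τ, hτ⟩ := exists_ordering_of_injective (fun w => (σ (φ w) : ℕ))
    (Fin.val_injective.comp (σ.injective.comp φ.injective))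
  refine ⟨τ, hσ.restrict φ hφ hτ, fun u => ?_⟩
  by_contra! h
  exact absurd (hlast (φ u)) (not_le.2 ((hτ x u).1 h))

/-- Every vertex of a complete graph is an end vertex. -/
lemma isEndVertex_of_pairwise_adj {W : Type*} [Finite W] {H : SimpleGraph W}
    (hH : ∀ u v, u ≠ v → H.Adj u v) (x : W) : IsEndVertex H x := by
  classical
  let e := Finite.equivFin W
  obtain ⟨τ, hτ⟩ := exists_ordering_of_injective
    (fun w => if w = x then Nat.card W else (e w : ℕ)) (by
      intro u v huv
      have hu := (e u).isLt
      have hv := (e v).isLt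
      dsimp only at huv
      split_ifs at huv with h1 h2 h2
      · rw [h1, h2]
      · omega
      · omega
      · exact e.injective (Fin.ext huv))
  refine ⟨τ, fun a b c hab _ _ hnab => ?_, fun u => ?_⟩
  · refine absurd (hH a b ?_) hnab
    rintro rfl
    exact lt_irrefl _ hab
  · by_contra! h
    have h := (hτ x u).1 h
    have hu := (e u).isLt
    rw [if_pos rfl] at h
    split_ifs at h <;> omega

/-- An interval graph has no induced cycle of length four. -/
lemma IsIntervalGraph.adj_of_common_neighbors {V : Type*} {G : SimpleGraph V}
    (hG : IsIntervalGraph G) {p q r s : V} (hpq : p ≠ q) (hnpq : ¬ G.Adj p q) (hrs : r ≠ s)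
    (hpr : G.Adj p r) (hps : G.Adj p s) (hqr : G.Adj q r) (hqs : G.Adj q s) :
    G.Adj r s := by
  obtain ⟨I, hI, hadj⟩ := hG
  have key : ∀ u v, u ≠ v → ∀ a b c d : ℝ, I u = Set.Icc a b → I v = Set.Icc c d →
      a ≤ b → c ≤ d → (G.Adj u v ↔ a ≤ d ∧ c ≤ b) := by
    intro u v huv a b c d hu hv hab hcd
    rw [hadj u v huv, hu, hv, Set.Icc_inter_Icc, Set.nonempty_Icc]
    simp only [sup_le_iff, le_inf_iff]
    tauto
  obtain ⟨ap, bp, hp, hIp⟩ := hI p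
  obtain ⟨aq, bq, hq, hIq⟩ := hI q
  obtain ⟨ar, br, hr, hIr⟩ := hI r
  obtain ⟨as, bs, hs, hIs⟩ := hI s
  rw [key p q hpq _ _ _ _ hIp hIq hp hq] at hnpq
  have h1 := (key p r hpr.ne _ _ _ _ hIp hIr hp hr).1 hpr
  have h2 := (key p s hps.ne _ _ _ _ hIp hIs hp hs).1 hps
  have h3 := (key q r hqr.ne _ _ _ _ hIq hIr hq hr).1 hqr
  have h4 := (key q s hqs.ne _ _ _ _ hIq hIs hq hs).1 hqs
  rw [key r s hrs _ _ _ _ hIr hIs hr hs]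
  by_cases h : ap ≤ bq
  · have h5 : bp < aq := not_le.1 fun h' => hnpq ⟨h, h'⟩
    constructor <;> linarith
  · constructor <;> linarith

/-- If `y` is a later vertex outside the snapshot of `x` in an LBFS ordering, then some
vertex before `x` is adjacent to `x` but not to `y`. -/
lemma IsLBFSOrdering.exists_separating {V : Type*} [Finite V] {G : SimpleGraph V}
    {σ : V ≃ Fin (Nat.card V)} (hσ : IsLBFSOrdering G σ) {x y : V} (hxy : σ x < σ y)
    (hy : y ∉ snapshot G σ x) : ∃ z, σ z < σ x ∧ G.Adj z x ∧ ¬ G.Adj z y := by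
  by_contra! h
  refine hy ⟨hxy.le, Set.ext fun z => ⟨fun hz => ⟨hz.1, ?_⟩, fun hz => ⟨hz.1, h z hz.1 hz.2⟩⟩⟩
  by_contra hzx
  obtain ⟨d, hd, hdx, hdy⟩ := hσ z x y hz.1 hxy hz.2 hzx
  exact hdy (h d (hd.trans hz.1) hdx)

/-- A vertex witnessing exposure from a snapshot comes after the start of the snapshot. -/
lemma lt_of_adj_of_notMem_snapshot {V : Type*} [Finite V] {G : SimpleGraph V}
    {σ : V ≃ Fin (Nat.card V)} {x v u : V} (hv : v ∈ snapshot G σ x) (hvu : G.Adj v u)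
    (hu : u ∉ earlyNbhd G σ x ∪ snapshot G σ x) : σ x < σ u := by
  by_contra! h
  rcases h.lt_or_eq with h | h
  · refine hu (Or.inl ?_)
    rw [← hv.2]
    exact ⟨h, hvu.symm⟩
  · rw [σ.injective h] at hu
    exact hu (Or.inr ⟨le_rfl, rfl⟩)

/-- Snapshots of the restriction to a module are restrictions of snapshots. -/
lemma mem_snapshot_induce_iff {V : Type*} [Finite V] {G : SimpleGraph V}
    {M : Set V} (hM : IsGraphModule G M) {σ : V ≃ Fin (Nat.card V)}
    {τ : ↥M ≃ Fin (Nat.card ↥M)} (hτ : ∀ u v : ↥M, τ u < τ v ↔ σ ↑u < σ ↑v) (x w : ↥M) :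
    w ∈ snapshot (G.induce M) τ x ↔ (w : V) ∈ snapshot G σ x := by
  have hle : τ x ≤ τ w ↔ σ ↑x ≤ σ ↑w := by rw [← not_lt, ← not_lt, hτ]
  refine and_congr hle ⟨fun h => Set.ext fun u => and_congr_right fun hu => ?_,
    fun h => Set.ext fun u => and_congr_right fun hu => ?_⟩
  · by_cases huM : u ∈ M
    · have := Set.ext_iff.1 h ⟨u, huM⟩
      simpa only [earlyNbhd, Set.mem_ofPred_eq, hτ, hu, true_and, SimpleGraph.comap_adj,
        Function.Embedding.subtype_apply] using this
    · rcases hM u huM with hu' | hu'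
      · exact iff_of_true (hu' _ w.2) (hu' _ x.2)
      · exact iff_of_false (hu' _ w.2) (hu' _ x.2)
  · have := Set.ext_iff.1 h u
    simpa [earlyNbhd, (hτ _ _).1 hu] using this

/-- In an interval graph, a module is a clique as soon as one of its vertices `x` has a
neighbor outside the module witnessing that `x` is exposed from its own snapshot. -/
lemma IsIntervalGraph.isClique_of_exposed {V : Type*} [Finite V] {G : SimpleGraph V}
    (hG : IsIntervalGraph G) {σ : V ≃ Fin (Nat.card V)} (hσ : IsLBFSOrdering G σ)
    {M : Set V} (hM : IsGraphModule G M) {x y : V} (hx : x ∈ M) (hy : y ∉ M)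
    (hxy : G.Adj x y) (hy' : y ∉ earlyNbhd G σ x ∪ snapshot G σ x) : G.IsClique M := by
  have hlt := lt_of_adj_of_notMem_snapshot ⟨le_rfl, rfl⟩ hxy hy'
  obtain ⟨z, hzx, hadj, hnadj⟩ := hσ.exists_separating hlt fun h => hy' (Or.inr h)
  have hyM : ∀ v ∈ M, G.Adj y v := (hM y hy).resolve_right fun h => h x hx hxy.symm
  have hzM : ∀ v ∈ M, G.Adj z v :=
    (hM z fun h => hnadj (hyM z h).symm).resolve_right fun h => h x hx hadj
  have hne : z ≠ y := by
    rintro rfl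
    exact lt_asymm hzx hlt
  exact fun u hu v hv huv => hG.adj_of_common_neighbors hne hnadj huv (hzM u hu) (hzM v hv)
    (hyM u hu) (hyM v hv)

/-- A vertex of a module is exposed from a snapshot of the restriction iff it is exposed
from the corresponding snapshot of the whole graph by a vertex of the module. -/
lemma exposedFrom_induce_iff {V : Type*} [Finite V] {G : SimpleGraph V}
    {M : Set V} (hM : IsGraphModule G M) {σ : V ≃ Fin (Nat.card V)}
    {τ : ↥M ≃ Fin (Nat.card ↥M)} (hτ : ∀ u v : ↥M, τ u < τ v ↔ σ ↑u < σ ↑v) (x v : ↥M) :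
    ExposedFrom (G.induce M) τ x v ↔ (v : V) ∈ snapshot G σ x ∧
      ∃ u ∈ M, G.Adj v u ∧ u ∉ earlyNbhd G σ x ∪ snapshot G σ x := by
  simp only [ExposedFrom, mem_snapshot_induce_iff hM hτ, Set.Nonempty, Set.mem_sdiff,
    Set.mem_union, SimpleGraph.mem_neighborSet, earlyNbhd, Set.mem_ofPred_eq, hτ,
    SimpleGraph.comap_adj, Function.Embedding.subtype_apply, Subtype.exists, exists_prop]

/-- restricting a well-anchored LBFS ordering `π` of an interval graph and
`π⁺ = LBFS⁺(G, π)` to a module `M` gives a well-anchored LBFS ordering of `G[M]`, and the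
restriction of `π⁺` is `LBFS⁺(G[M], π|_M)`. -/
theorem well_anchored_restricts_to_module {V : Type*} [Finite V]
    (G : SimpleGraph V) (hG : IsIntervalGraph G)
    (π πp : V ≃ Fin (Nat.card V))
    (hπ : IsWellAnchored G π) (hπp : IsLBFSPlusOf G π πp)
    (M : Set V) (hM : IsGraphModule G M)
    (ρ ρp : ↥M ≃ Fin (Nat.card ↥M))
    (hρ : ∀ u v : ↥M, ρ u < ρ v ↔ π ↑u < π ↑v)
    (hρp : ∀ u v : ↥M, ρp u < ρp v ↔ πp ↑u < πp ↑v) :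
    IsWellAnchored (G.induce M) ρ ∧ IsLBFSPlusOf (G.induce M) ρ ρp := by
  have hmod : IsGraphModule G (Set.range (SimpleGraph.Embedding.induce (G := G) M)) := by
    intro y hy
    have hyM : y ∉ M := fun h => hy ⟨⟨y, h⟩, rfl⟩
    refine (hM y hyM).imp ?_ ?_ <;>
    · rintro h _ ⟨v, rfl⟩
      exact h _ v.2
  refine ⟨⟨hπ.1.restrict (SimpleGraph.Embedding.induce M) hmod hρ, fun x => ⟨?_, ?_⟩⟩,
    hπp.1.restrict (SimpleGraph.Embedding.induce M) hmod hρp, fun v w hw => ?_⟩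
  · rintro ⟨v, hv⟩
    obtain ⟨hvS, u, huM, hvu, hu⟩ := (exposedFrom_induce_iff hM hρ x v).1 hv
    obtain ⟨hxS, y, hxy, hy⟩ := (hπ.2 x).1 ⟨v, hvS, u, hvu, hu⟩
    refine (exposedFrom_induce_iff hM hρ x x).2 ⟨hxS, ?_⟩
    by_cases hyM : y ∈ M
    · exact ⟨y, hyM, hxy, hy⟩
    · refine ⟨u, huM, ?_, hu⟩
      refine hG.isClique_of_exposed hπ.1 hM x.2 hyM hxy hy x.2 huM ?_
      rintro rfl
      exact hu (Or.inr hxS)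
  · intro hnone
    have hxS : x ∈ snapshot (G.induce M) ρ x := ⟨le_rfl, rfl⟩
    refine ⟨hxS, ?_⟩
    by_cases hex : ∃ v, ExposedFrom G π x v
    · obtain ⟨hxS', y, hxy, hy⟩ := (hπ.2 x).1 hex
      have hyM : y ∉ M := fun h =>
        hnone ⟨x, (exposedFrom_induce_iff hM hρ x x).2 ⟨hxS', y, h, hxy, hy⟩⟩
      have hclique := hG.isClique_of_exposed hπ.1 hM x.2 hyM hxy hy
      exact isEndVertex_of_pairwise_adj
        (W := snapshot (G.induce M) ρ x)
        (fun u v huv => hclique u.1.2 v.1.2 fun h => huv (Subtype.ext (Subtype.ext h))) _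
    · obtain ⟨hxS', hend⟩ := (hπ.2 x).2 hex
      let φ : (G.induce M).induce (snapshot (G.induce M) ρ x) ↪g G.induce (snapshot G π x) :=
        { toFun := fun w => ⟨w.1.1, (mem_snapshot_induce_iff hM hρ x w.1).1 w.2⟩
          inj' := fun u v h => Subtype.ext (Subtype.ext (Subtype.mk.inj h))
          map_rel_iff' := Iff.rfl }
      refine IsEndVertex.restrict φ ?_ hend
      intro y hy
      have hyM : (y : V) ∉ M := fun h =>
        hy ⟨⟨⟨y, h⟩, (mem_snapshot_induce_iff hM hρ x ⟨y, h⟩).2 y.2⟩, rfl⟩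
      refine (hM y hyM).imp ?_ ?_ <;>
      · rintro h _ ⟨v, rfl⟩
        exact h _ v.1.2
  · have h := hπp.2 v w ((mem_snapshot_induce_iff hM hρp v w).1 hw)
    rw [← not_lt] at h ⊢
    rwa [hρ]
end

section
/- Let G be an interval graph and let π be a well-anchored LBFS ordering of G. Then LBFS⁺(G, π) is an interval ordering of G. -/
open SimpleGraph

/-- `π` satisfies the four-point LBFS condition on the vertex set `A`. -/
def LBFSOn {V : Type*} (G : SimpleGraph V) (A : Finset V) (π : V → ℕ) : Prop :=
  ∀ a ∈ A, ∀ b ∈ A, ∀ c ∈ A, π a < π b → π b < π c → G.Adj a c → ¬ G.Adj a b →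
    ∃ d ∈ A, π d < π a ∧ G.Adj d b ∧ ¬ G.Adj d c

/-- `f` lists the vertices of `A` as an interval ordering. -/
def IntervalOn {V : Type*} (G : SimpleGraph V) (A : Finset V) (f : V → ℕ) : Prop :=
  ∀ a ∈ A, ∀ b ∈ A, ∀ c ∈ A, f a < f b → f b < f c → G.Adj a c → G.Adj a b

/-- `x ↦ [l x, r x]` is an interval representation of `G` on `A`. -/
def RepresentsOn {V α : Type*} [LinearOrder α] (G : SimpleGraph V) (A : Finset V)
    (l r : V → α) : Prop :=
  (∀ a ∈ A, l a ≤ r a) ∧ ∀ a ∈ A, ∀ b ∈ A, a ≠ b → (G.Adj a b ↔ l a ≤ r b ∧ l b ≤ r a)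

section Keys

variable {V : Type*} {G : SimpleGraph V}

theorem exists_nat_rank [Finite V] {α : Type*} [LinearOrder α] (k : V → α) :
    ∃ f : V → ℕ, ∀ x y, f x < f y ↔ k x < k y := by
  classical
  have := Fintype.ofFinite V
  have key : ∀ x y, k x < k y →
      (Finset.univ.filter fun z => k z < k x).card <
        (Finset.univ.filter fun z => k z < k y).card := by
    intro x y h
    apply Finset.card_lt_card
    refine ⟨fun z hz => ?_, fun hs => ?_⟩
    · simp only [Finset.mem_filter, Finset.mem_univ, true_and] at hz ⊢
      exact hz.trans h
    · have := hs (by simpa using h : x ∈ _)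
      simp at this
  refine ⟨fun x => (Finset.univ.filter fun z => k z < k x).card, fun x y => ⟨fun h => ?_, key x y⟩⟩
  by_contra! hle
  rcases hle.lt_or_eq with hlt | heq
  · exact absurd (key y x hlt) (by simp only at h; omega)
  · simp [heq] at h

theorem exists_lex_key [Finite V] {α β : Type*} [LinearOrder α] [LinearOrder β]
    (b : V → α) (k : V → β) :
    ∃ f : V → ℕ, ∀ x y, f x < f y ↔ b x < b y ∨ (b x = b y ∧ k x < k y) := by
  obtain ⟨f, hf⟩ := exists_nat_rank (fun x => toLex (b x, k x))
  exact ⟨f, fun x y => by rw [hf, Prod.Lex.toLex_lt_toLex]⟩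

theorem exists_key_of_representsOn [Finite V] {α : Type*} [LinearOrder α] {A : Finset V}
    {l r : V → α} (h : RepresentsOn G A l r) :
    ∃ f : V → ℕ, Function.Injective f ∧ IntervalOn G A f ∧ ∀ x y, l x < l y → f x < f y := by
  obtain ⟨n, ⟨e⟩⟩ := Finite.exists_equiv_fin V
  obtain ⟨f, hf⟩ := exists_lex_key l (fun x => e x)
  refine ⟨f, fun x y hxy => ?_, ?_, fun x y hxy => (hf x y).2 (Or.inl hxy)⟩
  · have h1 := hf x y
    have h2 := hf y x
    apply e.injective
    rcases lt_trichotomy (l x) (l y) with h | h | h <;>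
      rcases lt_trichotomy (e x) (e y) with h' | h' | h' <;> grind
  · intro a ha b hb c hc hab hbc hac
    have h1 : l a ≤ l b := by rcases (hf a b).1 hab with h | h; exacts [h.le, h.1.le]
    have h2 : l b ≤ l c := by rcases (hf b c).1 hbc with h | h; exacts [h.le, h.1.le]
    have h3 := ((h.2 a ha c hc hac.ne).1 hac).2
    refine (h.2 a ha b hb (by rintro rfl; omega)).2 ⟨h1.trans (h.1 b hb), h2.trans h3⟩

theorem IntervalOn.exists_representsOn {A : Finset V} {f : V → ℕ} (hinj : Function.Injective f)
    (hf : IntervalOn G A f) : ∃ R : V → ℕ, RepresentsOn G A f R := by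
  classical
  have key : ∀ a, ∃ m, a ∈ A → f a ≤ m ∧ (∀ b ∈ A, G.Adj a b → f b ≤ m) ∧
      ∃ c ∈ A, (c = a ∨ G.Adj a c) ∧ f c = m := by
    intro a
    by_cases ha : a ∈ A
    · obtain ⟨c, hc, hmax⟩ := Finset.exists_max_image (A.filter fun c => c = a ∨ G.Adj a c) f
        ⟨a, by simp [ha]⟩
      refine ⟨f c, fun _ => ?_⟩
      simp only [Finset.mem_filter] at hc hmax
      grind
    · exact ⟨0, fun h => absurd h ha⟩
  choose R hR using key
  have half : ∀ a ∈ A, ∀ b ∈ A, f a < f b → (G.Adj a b ↔ f b ≤ R a) := by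
    intro a ha b hb hab
    obtain ⟨-, h2, c, hc, hac, hcR⟩ := hR a ha
    refine ⟨h2 b hb, fun h => ?_⟩
    rcases hac with rfl | hac
    · omega
    · rcases (hcR ▸ h : f b ≤ f c).lt_or_eq with hlt | heq
      · exact hf a ha b hb c hc hab hlt hac
      · exact hinj heq ▸ hac
  refine ⟨R, fun a ha => (hR a ha).1, fun a ha b hb hab => ?_⟩
  have ha' := (hR a ha).1
  have hb' := (hR b hb).1
  rcases lt_or_gt_of_ne (hinj.ne hab) with h | h
  · rw [half a ha b hb h]; constructor <;> intro <;> omega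
  · rw [G.adj_comm, half b hb a ha h]; constructor <;> intro <;> omega

theorem IntervalOn.exists_reverse [Finite V] {A : Finset V} {f : V → ℕ}
    (hinj : Function.Injective f) (hf : IntervalOn G A f) :
    ∃ g : V → ℕ, Function.Injective g ∧ IntervalOn G A g ∧
      ∀ x ∈ A, ∀ y ∈ A, ¬ G.Adj x y → f x < f y → g y < g x := by
  obtain ⟨R, hR⟩ := hf.exists_representsOn hinj
  have hrev : RepresentsOn G A (fun x => OrderDual.toDual (R x))
      (fun x => OrderDual.toDual (f x)) := by
    refine ⟨fun a ha => OrderDual.toDual_le_toDual.2 (hR.1 a ha), fun a ha b hb hab => ?_⟩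
    rw [hR.2 a ha b hb hab]
    simp only [OrderDual.toDual_le_toDual]
    tauto
  obtain ⟨g, hg, hgI, hlt⟩ := exists_key_of_representsOn hrev
  refine ⟨g, hg, hgI, fun x hx y hy hxy hlt' => hlt y x ?_⟩
  have h1 := hR.2 x hx y hy (by rintro rfl; omega)
  have h2 := hR.1 y hy
  have h3 := hR.1 x hx
  rw [OrderDual.toDual_lt_toDual]
  by_contra! hcon
  exact hxy (h1.2 ⟨by omega, by omega⟩)

/-- Two nonadjacent common neighbours force a clique. -/
theorem RepresentsOn.adj_of_common_neighbors {A : Finset V} {f R : V → ℕ}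
    (h : RepresentsOn G A f R) {a b c d : V} (ha : a ∈ A) (hb : b ∈ A) (hc : c ∈ A) (hd : d ∈ A)
    (hab : a ≠ b) (hcd : c ≠ d) (hca : G.Adj c a) (hcb : G.Adj c b) (hda : G.Adj d a)
    (hdb : G.Adj d b) (hn : ¬ G.Adj c d) : G.Adj a b := by
  have h1 := (h.2 c hc a ha hca.ne).1 hca
  have h2 := (h.2 c hc b hb hcb.ne).1 hcb
  have h3 := (h.2 d hd a ha hda.ne).1 hda
  have h4 := (h.2 d hd b hb hdb.ne).1 hdb
  have h5 := h.2 c hc d hd hcd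
  rw [h.2 a ha b hb hab]
  by_contra h6
  exact hn (h5.2 (by omega))

/-- Moving a module `T` of the block `S` to the front of `S`, led by `v`, keeps an
interval ordering, provided that the neighbours of `T` in `S` form a clique lying before
the rest of `S`. -/
theorem IntervalOn.exists_move_front [Finite V] {A S T : Finset V} {f g : V → ℕ} {v w : V}
    (hinj : Function.Injective f) (hf : IntervalOn G A f) (hSA : S ⊆ A) (hTS : T ⊆ S)
    (hv : v ∈ T) (hw : w ∈ T) (hginj : Function.Injective g) (hg : IntervalOn G T g)
    (hgv : ∀ t ∈ T, g v ≤ g t)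
    (hblock : ∀ a ∈ A, a ∉ S →
      ((∀ s ∈ S, f a < f s) ∧ ∀ s ∈ S, ∀ s' ∈ S, G.Adj a s → G.Adj a s') ∨
      ((∀ s ∈ S, f s < f a) ∧ ∀ t ∈ T, G.Adj t a → ∀ x ∈ S, ∀ y ∈ S, x ≠ y → G.Adj x y))
    (hmod : ∀ s ∈ S, s ∉ T → ∀ t ∈ T, ∀ t' ∈ T, G.Adj s t → G.Adj s t')
    (hclique : ∀ x ∈ S, x ∉ T → G.Adj x w → ∀ y ∈ S, y ∉ T → G.Adj y w → x ≠ y → G.Adj x y)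
    (hbefore : ∀ x ∈ S, x ∉ T → G.Adj x w → ∀ y ∈ S, y ∉ T → ¬ G.Adj y w → f x < f y) :
    ∃ f' : V → ℕ, Function.Injective f' ∧ IntervalOn G A f' ∧
      (∀ s ∈ S, s ≠ v → f' v < f' s) ∧
      ∀ x ∈ A, ∀ y ∈ A, (x ∉ S ∨ y ∉ S) → (f' x < f' y ↔ f x < f y) := by
  classical
  have hvS := hTS hv
  obtain ⟨b, hb⟩ : ∃ b : V → ℕ, ∀ x, b x =
      if x ∈ S then
        if x = v then 1 else if x ∈ T then 3 else if G.Adj x w then 2 else 4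
      else if f x < f v then 0 else 5 := ⟨_, fun _ => rfl⟩
  obtain ⟨f', hf'⟩ := exists_lex_key b (fun x => if x ∈ T then g x else f x)
  have hP : ∀ a, b a = 0 ↔ a ∉ S ∧ f a < f v := by intro a; rw [hb]; grind
  have h1 : ∀ a, b a = 1 ↔ a = v := by intro a; rw [hb]; grind
  have h2 : ∀ a, b a = 2 ↔ a ∈ S ∧ a ∉ T ∧ G.Adj a w := by intro a; rw [hb]; grind
  have h3 : ∀ a, b a = 3 ↔ a ∈ T ∧ a ≠ v := by intro a; rw [hb]; grind
  have h4 : ∀ a, b a = 4 ↔ a ∈ S ∧ a ∉ T ∧ ¬ G.Adj a w := by intro a; rw [hb]; grind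
  have h5 : ∀ a, b a = 5 ↔ a ∉ S ∧ ¬ f a < f v := by intro a; rw [hb]; grind
  have hcases : ∀ a, b a = 0 ∨ b a = 1 ∨ b a = 2 ∨ b a = 3 ∨ b a = 4 ∨ b a = 5 := by
    intro a; rw [hb]; grind
  clear hb
  have hout : ∀ x ∈ A, ∀ y ∈ A, (x ∉ S ∨ y ∉ S) → (f' x < f' y ↔ f x < f y) := by
    intro x hx y hy hxy
    rw [hf']
    have := hcases x
    have := hcases y
    by_cases hxS : x ∈ S
    · have := hblock y hy
      grind
    · by_cases hyS : y ∈ S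
      · have := hblock x hx
        grind
      · have := hblock x hx
        have := hblock y hy
        grind
  refine ⟨f', fun x y hxy => ?_, ?_, ?_, ?_⟩
  · have e1 := hf' x y
    have e2 := hf' y x
    have hbxy : b x = b y := by omega
    have hT : x ∈ T ↔ y ∈ T := by
      have := hcases x
      grind
    by_cases hx : x ∈ T
    · exact hginj (by grind)
    · exact hinj (by grind)
  · intro a ha p hp c hc hap hpc hac
    have hf1 := hf a ha p hp c hc
    have hadj : ∀ t ∈ T, ∀ s ∈ S, s ∉ T → (G.Adj s w ↔ G.Adj s t) := fun t ht s hs hsT =>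
      ⟨hmod s hs hsT w hw t ht, hmod s hs hsT t ht w hw⟩
    have hgT : ∀ t ∈ T, t ≠ v → g v < g t := fun t ht htv =>
      lt_of_le_of_ne (hgv t ht) (hginj.ne htv.symm)
    by_cases haS : a ∈ S
    · rw [hf'] at hap hpc
      by_cases haT : a ∈ T
      · by_cases hcS : c ∈ S
        · by_cases hcT : c ∈ T
          · by_cases hpT : p ∈ T
            · have := hg a haT p hpT c hcT
              have := hcases a
              have := hcases p
              have := hcases c
              grind
            · have := hcases a
              have := hcases p
              have := hcases c
              have : G.Adj p w := by grind
              have := (hadj a haT p (by grind) hpT).1 this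
              exact this.symm
          · have hcw : G.Adj c w := (hadj a haT c hcS hcT).2 hac.symm
            have := hcases a
            have := hcases p
            have hpw : p ∈ S ∧ p ∉ T ∧ G.Adj p w := by grind
            exact ((hadj a haT p hpw.1 hpw.2.1).1 hpw.2.2).symm
        · have := hblock c hc hcS
          have := hcases a
          have := hcases p
          have hcl : ∀ x ∈ S, ∀ y ∈ S, x ≠ y → G.Adj x y := by grind
          by_cases hpS : p ∈ S
          · exact hcl a haS p hpS (by grind)
          · grind
      · by_cases haw : G.Adj a w
        · by_cases hpT : p ∈ T
          · exact (hadj p hpT a haS haT).1 haw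
          · have := hcases a
            have := hcases p
            have := hcases c
            by_cases hpS : p ∈ S
            · by_cases hpw : G.Adj p w
              · exact hclique a haS haT haw p hpS hpT hpw (by grind)
              · have := hbefore a haS haT haw p hpS hpT hpw
                have := hblock c hc
                grind
            · have := hblock p hp hpS
              have := hblock c hc
              grind
        · have ha4 : b a = 4 := (h4 a).2 ⟨haS, haT, haw⟩
          have hpT : p ∉ T := fun h => by have := hcases p; grind
          have hcT : c ∉ T := fun h => by have := hcases c; grind
          rw [if_neg haT, if_neg hpT] at hap
          rw [if_neg hpT, if_neg hcT] at hpc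
          have hafp : f a < f p := by
            have := hcases p
            have := hblock p hp
            grind
          have hpfc : f p < f c := by
            have := hcases p
            have := hcases c
            have := hblock p hp
            have := hblock c hc
            grind
          exact hf1 hafp hpfc hac
    · have hafp := (hout a ha p hp (Or.inl haS)).1 hap
      by_cases hps : p ∈ S ∧ c ∈ S
      · rcases hblock a ha haS with h | h
        · exact h.2 c hps.2 p hps.1 hac
        · have := h.1 p hps.1
          omega
      · exact hf1 hafp ((hout p hp c hc (by tauto)).1 hpc) hac
  · intro s hs hsv
    rw [hf']
    grind
  · exact hout

end Keys

section LBFS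

variable {V : Type*} {G : SimpleGraph V} {A : Finset V} {π : V → ℕ}

theorem LBFSOn.adj_of_adj (hπ : LBFSOn G A π) {b c : V} (hb : b ∈ A) (hc : c ∈ A)
    (hbc : π b < π c) (hsub : ∀ h ∈ A, π h < π b → G.Adj h b → G.Adj h c) {h : V} (hh : h ∈ A)
    (hhb : π h < π b) (hhc : G.Adj h c) : G.Adj h b := by
  by_contra hn
  obtain ⟨d, hd, hdh, hdb, hdc⟩ := hπ h hh b hb c hc hhb hbc hhc hn
  exact hdc (hsub d hd (hdh.trans hhb) hdb)

/-- Snapshots of an LBFS are contiguous. -/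
theorem LBFSOn.tied_of_between (hπ : LBFSOn G A π) (hinj : Set.InjOn π A) {a b c : V}
    (ha : a ∈ A) (hb : b ∈ A) (hc : c ∈ A) (hab : π a ≤ π b) (hbc : π b ≤ π c)
    (htied : ∀ h ∈ A, π h < π a → (G.Adj h a ↔ G.Adj h c)) :
    ∀ h ∈ A, π h < π a → (G.Adj h a ↔ G.Adj h b) := by
  rcases hab.eq_or_lt with heq | hab
  · rw [hinj ha hb heq]; simp
  rcases hbc.eq_or_lt with heq | hbc
  · rwa [hinj hb hc heq]
  have hsub : ∀ n, ∀ h ∈ A, π h = n → π h < π a → G.Adj h a → G.Adj h b := by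
    intro n
    induction n using Nat.strong_induction_on with
    | _ n ih =>
      intro h hh hn hha hadj
      by_contra hnb
      obtain ⟨d, hd, hdh, hdb, hdc⟩ := hπ h hh b hb c hc (hha.trans hab) hbc
        ((htied h hh hha).1 hadj) hnb
      have hda : ¬ G.Adj d a := fun h' => hdc ((htied d hd (hdh.trans hha)).1 h')
      obtain ⟨e, he, hed, hea, heb⟩ := hπ d hd a ha b hb (hdh.trans hha) hab hdb hda
      exact heb (ih (π e) (by omega) e he rfl (by omega) hea)
  exact fun h hh hha => ⟨hsub _ h hh rfl hha,
    hπ.adj_of_adj ha hb hab (fun h hh hha => hsub _ h hh rfl hha) hh hha⟩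

theorem LBFSOn.mono_of_module {B : Finset V} (hπ : LBFSOn G A π) (hBA : B ⊆ A)
    (hmod : ∀ h ∈ A, h ∉ B → ∀ x ∈ B, ∀ y ∈ B, G.Adj h x → G.Adj h y) : LBFSOn G B π := by
  intro a ha b hb c hc hab hbc hac hn
  obtain ⟨d, hd, hda, hdb, hdc⟩ := hπ a (hBA ha) b (hBA hb) c (hBA hc) hab hbc hac hn
  exact ⟨d, by by_contra h; exact hdc (hmod d hd h b hb c hc hdb), hda, hdb, hdc⟩

/-- In an LBFS, the last vertex `v` of `S` is tied with the first vertex of `S` whose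
interval either ends before `v` starts or has the leftmost right end. -/
theorem LBFSOn.exists_tied {B S : Finset V} {f R : V → ℕ} {v w : V} (hπ : LBFSOn G A π)
    (hinj : Set.InjOn π A) (hBA : B ⊆ A) (hSB : S ⊆ B) (hR : RepresentsOn G B f R)
    (hw : w ∈ S) (hwmin : ∀ s ∈ S, R w ≤ R s) (hv : v ∈ S) (hvmax : ∀ s ∈ S, π s ≤ π v)
    (hright : ∀ b ∈ B, b ∉ S → f v ≤ R b)
    (hunif : ∀ a ∈ A, a ∉ B → ∀ s ∈ S, ∀ s' ∈ S, G.Adj a s → G.Adj a s') :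
    ∃ u ∈ S, (u = w ∨ R u < f v) ∧ π u ≤ π w ∧
      ∀ h ∈ A, π h < π u → (G.Adj h u ↔ G.Adj h v) := by
  classical
  obtain ⟨u, hu, hmin⟩ := Finset.exists_min_image (S.filter fun u => u = w ∨ R u < f v) π
    ⟨w, by simp [hw]⟩
  simp only [Finset.mem_filter, and_imp] at hu hmin
  refine ⟨u, hu.1, hu.2, hmin w hw (Or.inl rfl), ?_⟩
  rcases eq_or_ne u v with rfl | huv
  · simp
  have huv' : π u < π v := lt_of_le_of_ne (hvmax u hu.1)
    fun h => huv (hinj (hBA (hSB hu.1)) (hBA (hSB hv)) h)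
  have hsub : ∀ h ∈ A, π h < π u → G.Adj h u → G.Adj h v := by
    intro h hh hhu hadj
    by_cases hhB : h ∈ B
    · have h1 : f v ≤ R h := by
        by_cases hhS : h ∈ S
        · by_contra hlt
          have := hmin h hhS (Or.inr (by omega))
          omega
        · exact hright h hhB hhS
      have h2 := (hR.2 h hhB u (hSB hu.1) hadj.ne).1 hadj
      have h3 := hR.1 v (hSB hv)
      have h4 := hwmin v hv
      refine (hR.2 h hhB v (hSB hv) (by rintro rfl; omega)).2 ⟨?_, h1⟩
      rcases hu.2 with rfl | h5 <;> omega
    · exact hunif h hh hhB u hu.1 v hv hadj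
  exact fun h hh hhu => ⟨hsub h hh hhu,
    hπ.adj_of_adj (hBA (hSB hu.1)) (hBA (hSB hv)) huv' hsub hh hhu⟩

/-- The vertices reachable from `u` in `A` along increasing paths avoiding the closed
neighbourhood of `r`. -/
def ReachAvoiding (G : SimpleGraph V) (A : Finset V) (ρ : V → ℕ) (u r : V) : V → Prop :=
  Relation.ReflTransGen (fun x y => G.Adj x y ∧ ρ x < ρ y ∧ y ∈ A ∧ ¬ G.Adj y r) u

section Reach

variable {ρ : V → ℕ} {u r m : V}

theorem ReachAvoiding.mem (hu : u ∈ A) (h : ReachAvoiding G A ρ u r m) : m ∈ A := by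
  induction h with
  | refl => exact hu
  | tail _ h _ => exact h.2.2.1

theorem ReachAvoiding.not_adj (hur : ¬ G.Adj u r) (h : ReachAvoiding G A ρ u r m) :
    ¬ G.Adj m r := by
  induction h with
  | refl => exact hur
  | tail _ h _ => exact h.2.2.2

theorem ReachAvoiding.lt (hρ : IntervalOn G A ρ) (hinj : Set.InjOn ρ A) (hu : u ∈ A) (hr : r ∈ A)
    (hmin : ∀ a ∈ A, ρ u ≤ ρ a) (hur : ¬ G.Adj u r) (hne : u ≠ r)
    (h : ReachAvoiding G A ρ u r m) : ρ m < ρ r := by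
  induction h with
  | refl => exact lt_of_le_of_ne (hmin r hr) fun h => hne (hinj hu hr h)
  | @tail b c hab hbc ih =>
    have hbr := ReachAvoiding.not_adj hur hab
    have hb := ReachAvoiding.mem hu hab
    by_contra hle
    rcases (not_lt.1 hle).eq_or_lt with heq | hlt
    · exact hbr (hinj hr hbc.2.2.1 heq ▸ hbc.1)
    · exact hbr (hρ b hb r hr c hbc.2.2.1 ih hlt hbc.1)

theorem ReachAvoiding.of_avoiding {d : V} (h : ReachAvoiding G A ρ u r m)
    (hd : ∀ k, ReachAvoiding G A ρ u r k → ρ k ≤ ρ m → ¬ G.Adj k d) :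
    ReachAvoiding G A ρ u d m := by
  induction h with
  | refl => exact Relation.ReflTransGen.refl
  | tail hab hbc ih =>
    exact (ih fun k hk hle => hd k hk (hle.trans hbc.2.1.le)).tail
      ⟨hbc.1, hbc.2.1, hbc.2.2.1, hd _ (hab.tail hbc) le_rfl⟩

theorem ReachAvoiding.closed (hρ : IntervalOn G A ρ) (hinj : Set.InjOn ρ A) (hu : u ∈ A)
    (hmin : ∀ a ∈ A, ρ u ≤ ρ a) {h : V} (hm : ReachAvoiding G A ρ u r m) (hh : h ∈ A)
    (hadj : G.Adj h m) (hhr : ¬ G.Adj h r) : ReachAvoiding G A ρ u r h := by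
  induction hm with
  | refl =>
    refine Relation.ReflTransGen.single ⟨hadj.symm, ?_, hh, hhr⟩
    exact lt_of_le_of_ne (hmin h hh) fun e => hadj.ne (hinj hu hh e).symm
  | @tail b c hab hbc ih =>
    have hb := ReachAvoiding.mem hu hab
    rcases lt_trichotomy (ρ h) (ρ b) with hlt | heq | hlt
    · exact ih (hρ h hh b hb c hbc.2.2.1 hlt hbc.2.1 hadj)
    · rwa [hinj hh hb heq]
    · rcases lt_trichotomy (ρ h) (ρ c) with hlt' | heq' | hlt'
      · exact ih (hρ b hb h hh c hbc.2.2.1 hlt hlt' hbc.1).symm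
      · exact absurd (hinj hh hbc.2.2.1 heq') hadj.ne
      · exact (hab.tail hbc).tail ⟨hadj.symm, hlt', hh, hhr⟩

/-- An LBFS from an end vertex `u` exhausts the component of `u` in `G - N[r]` before
visiting `r`. -/
theorem ReachAvoiding.lbfs_lt (hρ : IntervalOn G A ρ) (hρinj : Set.InjOn ρ A)
    (hπ : LBFSOn G A π) (hπinj : Set.InjOn π A) (hu : u ∈ A) (hρmin : ∀ a ∈ A, ρ u ≤ ρ a)
    (hπmin : ∀ a ∈ A, π u ≤ π a) (hr : r ∈ A) (hur : ¬ G.Adj u r) (hne : u ≠ r)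
    (hm : ReachAvoiding G A ρ u r m) : π m < π r := by
  induction hn : π r using Nat.strong_induction_on generalizing r m with
  | _ n ihr =>
  subst hn
  induction hk : ρ m using Nat.strong_induction_on generalizing m with
  | _ k ihm =>
  subst hk
  classical
  by_contra hcon
  have hmA := hm.mem hu
  have hmr := hm.not_adj hur
  have hmlt := hm.lt hρ hρinj hu hr hρmin hur hne
  have hlt : π r < π m := lt_of_le_of_ne (not_lt.1 hcon) fun h => by
    have := hπinj hr hmA h
    subst this
    omega
  have hmu : m ≠ u := by rintro rfl; exact absurd (hπmin r hr) (by omega)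
  obtain ⟨p, hp, hpm⟩ : ∃ p, ReachAvoiding G A ρ u r p ∧ G.Adj p m ∧ ρ p < ρ m := by
    rcases Relation.ReflTransGen.cases_tail hm with h | ⟨p, hp, h⟩
    · exact absurd h hmu
    · exact ⟨p, hp, h.1, h.2.1⟩
  obtain ⟨q, hq, hqmin⟩ := Finset.exists_min_image
    (A.filter fun q => ReachAvoiding G A ρ u r q ∧ G.Adj q m) ρ
    ⟨p, by simp [hp, hpm, hp.mem hu]⟩
  simp only [Finset.mem_filter, and_imp] at hq hqmin
  obtain ⟨hqA, hq, hqm⟩ := hq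
  have hqlt : ρ q < ρ m := (hqmin p (hp.mem hu) hp hpm.1).trans_lt hpm.2
  have hπq := ihm (ρ q) hqlt hq rfl
  have hfar : ∀ d ∈ A, ρ m < ρ d → ∀ k, ReachAvoiding G A ρ u r k → ρ k < ρ q → ¬ G.Adj k d := by
    intro d hd hmd k hk hkq hkd
    have hkA := hk.mem hu
    have := hqmin k hkA hk (hρ k hkA m hmA d hd (by omega) hmd hkd)
    omega
  obtain ⟨d, hd, hdq, hdr, hdm⟩ := hπ q hqA r hr m hmA hπq hlt hqm (hq.not_adj hur)
  have hmd : ρ m < ρ d := by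
    by_contra hle
    rcases (not_lt.1 hle).eq_or_lt with heq | hlt'
    · exact hmr (hρinj hd hmA heq ▸ hdr)
    · exact hdm (hρ d hd m hmA r hr hlt' hmlt hdr)
  have hqu : q ≠ u := by rintro rfl; exact absurd (hπmin d hd) (by omega)
  obtain ⟨n, hn, hnq⟩ : ∃ n, ReachAvoiding G A ρ u r n ∧ G.Adj n q ∧ ρ n < ρ q := by
    rcases Relation.ReflTransGen.cases_tail hq with h | ⟨p, hp, h⟩
    · exact absurd h hqu
    · exact ⟨p, hp, h.1, h.2.1⟩
  have hnA := hn.mem hu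
  have huq : ρ u < ρ q := (hρmin n hnA).trans_lt hnq.2
  have hu_far : ∀ e ∈ A, ρ m < ρ e → ¬ G.Adj u e ∧ u ≠ e := fun e he hme =>
    ⟨hfar e he hme u Relation.ReflTransGen.refl huq, by rintro rfl; omega⟩
  have hn_far : ∀ e ∈ A, ρ m < ρ e → ReachAvoiding G A ρ u e n := fun e he hme =>
    hn.of_avoiding fun k hk hkn => hfar e he hme k hk (hkn.trans_lt hnq.2)
  have hq_far : ∀ e ∈ A, ρ m < ρ e → ¬ G.Adj q e → ReachAvoiding G A ρ u e q :=
    fun e he hme hqe => (hn_far e he hme).tail ⟨hnq.1, hnq.2, hqA, hqe⟩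
  have hdlt : π d < π r := hdq.trans hπq
  have hqd : G.Adj q d := by
    by_contra hqd
    have hmD : ReachAvoiding G A ρ u d m :=
      (hq_far d hd hmd hqd).tail ⟨hqm, hqlt, hmA, fun h => hdm h.symm⟩
    have := ihr (π d) hdlt hd (hu_far d hd hmd).1 (hu_far d hd hmd).2 hmD rfl
    omega
  have hnd : π n < π d :=
    ihr (π d) hdlt hd (hu_far d hd hmd).1 (hu_far d hd hmd).2 (hn_far d hd hmd) rfl
  obtain ⟨e, he, hen, hed, heq⟩ := hπ n hnA d hd q hqA hnd hdq hnq.1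
    (hfar d hd hmd n hn hnq.2)
  have hde : ρ d < ρ e := by
    rcases lt_trichotomy (ρ e) (ρ q) with h | h | h
    · exact absurd (hρ e he q hqA d hd h (by omega) hed) heq
    · have := hρinj he hqA h
      subst this
      omega
    · by_contra hle
      rcases (not_lt.1 hle).eq_or_lt with h' | h'
      · exact hed.ne (hρinj he hd h')
      · exact heq (hρ q hqA e he d hd h h' hqd).symm
  have hme : ρ m < ρ e := hmd.trans hde
  have := ihr (π e) (by omega) he (hu_far e he hme).1 (hu_far e he hme).2
    (hq_far e he hme fun h => heq h.symm) rfl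
  omega

end Reach

end LBFS

/-- The last vertex of an LBFS ordering of an interval graph can start an interval ordering. -/
theorem LBFSOn.exists_intervalOn_from_last {V : Type*} [Finite V] {G : SimpleGraph V}
    {π f : V → ℕ} {A : Finset V} {v : V} (hf : IntervalOn G A f) (hfinj : Function.Injective f)
    (hπ : LBFSOn G A π) (hinj : Set.InjOn π A) (hv : v ∈ A) (hmax : ∀ a ∈ A, π a ≤ π v) :
    ∃ g : V → ℕ, Function.Injective g ∧ IntervalOn G A g ∧ ∀ a ∈ A, g v ≤ g a := by
  classical
  induction A using Finset.strongInduction generalizing f with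
  | H A ih =>
  have hfT : ∀ T ⊆ A, IntervalOn G T f := fun T hT a ha b hb c hc =>
    hf a (hT ha) b (hT hb) c (hT hc)
  obtain ⟨x, hx, hxmin⟩ := Finset.exists_min_image A π ⟨v, hv⟩
  rcases eq_or_ne x v with rfl | hxv
  · exact ⟨f, hfinj, hf, fun a ha =>
      (congrArg f (hinj hx ha ((hxmin a ha).antisymm (hmax a ha)))).le⟩
  suffices h : ∃ f' : V → ℕ, Function.Injective f' ∧ IntervalOn G A f' ∧
      ∀ s ∈ A, s ≠ v → f' v < f' s by
    obtain ⟨g, hg, hgI, hgv⟩ := h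
    refine ⟨g, hg, hgI, fun a ha => ?_⟩
    rcases eq_or_ne a v with rfl | hav
    · exact le_rfl
    · exact (hgv a ha hav).le
  by_cases hadj : G.Adj x v
  · have huniv : ∀ b ∈ A, b ≠ x → G.Adj x b := by
      intro b hb hbx
      by_contra hn
      have h1 : π x < π b := lt_of_le_of_ne (hxmin b hb) fun h => hbx (hinj hx hb h).symm
      have h2 : π b < π v := lt_of_le_of_ne (hmax b hb) fun h => hn (hinj hb hv h ▸ hadj)
      obtain ⟨d, hd, hdx, -⟩ := hπ x hx b hb v hv h1 h2 hadj hn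
      exact absurd (hxmin d hd) (by omega)
    have hTA : A.erase x ⊆ A := Finset.erase_subset x A
    obtain ⟨g, hg, hgI, hgv⟩ := ih (A.erase x) (Finset.erase_ssubset hx) (hfT _ hTA) hfinj
      (hπ.mono_of_module hTA fun h hh hhT y hy z hz _ => by
        have : h = x := by simpa [hh] using hhT
        subst this
        exact huniv z (hTA hz) (Finset.ne_of_mem_erase hz))
      (hinj.mono (by exact_mod_cast hTA)) (by simp [hv, hxv.symm])
      (fun a ha => hmax a (hTA ha))
    obtain ⟨f', hf', hI, hfv, -⟩ := hf.exists_move_front (S := A) (T := A.erase x) (v := v)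
      (w := v) hfinj subset_rfl hTA (by simp [hv, hxv.symm]) (by simp [hv, hxv.symm]) hg hgI hgv
      (fun a ha h => absurd ha h) (by grind) (by grind) (by grind)
    exact ⟨f', hf', hI, hfv⟩
  · obtain ⟨f, hfinj, hf, hvx⟩ : ∃ f : V → ℕ, Function.Injective f ∧ IntervalOn G A f ∧
        f v < f x := by
      rcases lt_or_gt_of_ne (hfinj.ne hxv) with h | h
      · obtain ⟨g, hg, hgI, hlt⟩ := hf.exists_reverse hfinj
        exact ⟨g, hg, hgI, hlt x hx v hv hadj h⟩
      · exact ⟨f, hfinj, hf, h⟩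
    have hfT : ∀ T ⊆ A, IntervalOn G T f := fun T hT a ha b hb c hc =>
      hf a (hT ha) b (hT hb) c (hT hc)
    obtain ⟨R, hR⟩ := hf.exists_representsOn hfinj
    obtain ⟨w, hw, hwmin⟩ := Finset.exists_min_image A R ⟨v, hv⟩
    obtain ⟨u, hu, huw, hπw, htied⟩ := hπ.exists_tied hinj subset_rfl subset_rfl hR hw hwmin hv
      hmax (fun b hb h => absurd hb h) (fun b hb h => absurd hb h)
    have hRx := hR.1 x hx
    have hRv : R v < f x := by
      have := hR.2 v hv x hx hxv.symm
      by_contra hle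
      exact hadj (this.2 ⟨by omega, by omega⟩).symm
    have hxu : π x < π u := by
      refine lt_of_le_of_ne (hxmin u hu) fun h => ?_
      have := hinj hx hu h
      subst this
      rcases huw with rfl | h'
      · have := hwmin v hv
        omega
      · omega
    have hTA : A.filter (fun a => π u ≤ π a) ⊆ A := Finset.filter_subset _ _
    have hmod : ∀ h ∈ A, h ∉ A.filter (fun a => π u ≤ π a) →
        ∀ y ∈ A.filter (fun a => π u ≤ π a), ∀ z ∈ A.filter (fun a => π u ≤ π a),
        G.Adj h y → G.Adj h z := by
      intro h hh hhT y hy z hz hhy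
      simp only [Finset.mem_filter] at hhT hy hz
      have hhu : π h < π u := by
        by_contra hle
        exact hhT ⟨hh, by omega⟩
      rw [← hπ.tied_of_between hinj hu hy.1 hv hy.2 (hmax y hy.1) htied h hh hhu] at hhy
      rwa [← hπ.tied_of_between hinj hu hz.1 hv hz.2 (hmax z hz.1) htied h hh hhu]
    obtain ⟨g, hg, hgI, hgv⟩ := ih (A.filter fun a => π u ≤ π a)
      ((Finset.filter_ssubset).2 ⟨x, hx, by omega⟩) (hfT _ hTA) hfinj
      (hπ.mono_of_module hTA hmod) (hinj.mono (by exact_mod_cast hTA))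
      (by simp [hv, hmax u hu]) (fun a ha => hmax a (hTA ha))
    obtain ⟨f', hf', hI, hfv, -⟩ := hf.exists_move_front (S := A) (v := v) (w := w) hfinj
      subset_rfl hTA (by simp [hv, hmax u hu]) (by simp [hw, hπw]) hg hgI hgv
      (fun a ha h => absurd ha h) hmod
      (fun y hy _ hyw z hz _ hzw hyz => by
        have h1 := (hR.2 y hy w hw hyw.ne).1 hyw
        have h2 := (hR.2 z hz w hw hzw.ne).1 hzw
        have h3 := hwmin y hy
        have h4 := hwmin z hz
        exact (hR.2 y hy z hz hyz).2 ⟨by omega, by omega⟩)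
      (fun y hy _ hyw z hz hzT hzw => by
        have h1 := (hR.2 y hy w hw hyw.ne).1 hyw
        have h4 := hwmin z hz
        have h5 := hR.1 w hw
        by_contra hle
        refine hzw ((hR.2 z hz w hw ?_).2 ⟨by omega, by omega⟩)
        rintro rfl
        exact hzT (by simp [hw, hπw]))
    exact ⟨f', hf', hI, hfv⟩

theorem IsEndVertexOn.exists_intervalOn {V : Type*} [Finite V] {G : SimpleGraph V}
    {f : V → ℕ} {Q : Finset V} {S : Set V} {u : V} (hQS : ∀ x, x ∈ Q ↔ x ∈ S)
    (hu : IsEndVertexOn G S u) (hf : IntervalOn G Q f) (hfinj : Function.Injective f) :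
    ∃ g : V → ℕ, Function.Injective g ∧ IntervalOn G Q g ∧ ∀ a ∈ Q, g u ≤ g a := by
  classical
  obtain ⟨huS, σ, hσ, hlast⟩ := hu
  have he : ∀ x : S, (fun x => if h : x ∈ S then ((σ ⟨x, h⟩ : Fin _) : ℕ) else 0) (x : V) =
      (σ x : ℕ) := fun x => by simp
  refine LBFSOn.exists_intervalOn_from_last (v := u)
    (π := fun x => if h : x ∈ S then (σ ⟨x, h⟩ : ℕ) else 0) hf hfinj ?_ ?_ ((hQS u).2 huS) ?_
  · intro a ha b hb c hc
    lift a to S using (hQS a).1 ha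
    lift b to S using (hQS b).1 hb
    lift c to S using (hQS c).1 hc
    rw [he, he, he]
    intro hab hbc hac hn
    obtain ⟨d, hda, hdb, hdc⟩ := hσ a b c hab hbc hac hn
    refine ⟨d, (hQS d).2 d.2, ?_, hdb, hdc⟩
    rw [he]
    exact hda
  · intro a ha b hb hab
    lift a to S using (hQS a).1 (by exact_mod_cast ha)
    lift b to S using (hQS b).1 (by exact_mod_cast hb)
    rw [he, he] at hab
    rw [σ.injective (Fin.ext hab)]
  · intro a ha
    lift a to S using (hQS a).1 ha
    have h1 := he a
    have h2 := he ⟨u, huS⟩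
    simp only at h1 h2
    rw [h1, h2]
    exact hlast a

/-- If `Q` is a module searched by `π` from an end `u` of an interval ordering of `Q`, then in
`LBFS⁺(G, π)` no non-neighbour of `u` in `Q` follows `u`. -/
theorem LBFSOn.not_lt_of_plus {V : Type*} [Fintype V] {G : SimpleGraph V} {p t ρ : V → ℕ}
    {Q : Finset V} {u r : V} (hp : LBFSOn G Finset.univ p) (hpinj : Function.Injective p)
    (ht : LBFSOn G Finset.univ t)
    (hplus : ∀ v w, t v ≤ t w → (∀ h, t h < t v → (G.Adj h v ↔ G.Adj h w)) → p w ≤ p v)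
    (hQ : ∀ h, h ∉ Q → ∀ x ∈ Q, ∀ y ∈ Q, G.Adj h x → G.Adj h y)
    (hρinj : Function.Injective ρ) (hρ : IntervalOn G Q ρ) (hu : u ∈ Q)
    (hρmin : ∀ a ∈ Q, ρ u ≤ ρ a) (hpmin : ∀ a ∈ Q, p u ≤ p a) (hr : r ∈ Q)
    (hur : ¬ G.Adj u r) (hne : u ≠ r) : ¬ t u < t r := by
  classical
  intro hlt
  obtain ⟨d, hd, hdmin⟩ := Finset.exists_min_image (Q.filter (ReachAvoiding G Q ρ u r)) t
    ⟨u, Finset.mem_filter.2 ⟨hu, Relation.ReflTransGen.refl⟩⟩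
  simp only [Finset.mem_filter, and_imp] at hd hdmin
  have hdu := hdmin u hu Relation.ReflTransGen.refl
  have hsub : ∀ h ∈ Finset.univ, t h < t d → G.Adj h d → G.Adj h r := by
    intro h _ hhd hadj
    by_cases hhQ : h ∈ Q
    · by_contra hn
      exact absurd (hdmin h hhQ (hd.2.closed hρ hρinj.injOn hu hρmin hhQ hadj hn)) (by omega)
    · exact hQ h hhQ d hd.1 r hr hadj
  have h1 := hplus d r (by omega) fun h hh => ⟨hsub h (Finset.mem_univ _) hh,
    ht.adj_of_adj (Finset.mem_univ _) (Finset.mem_univ _) (by omega) hsub (Finset.mem_univ _) hh⟩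
  have h2 := hd.2.lbfs_lt hρ hρinj.injOn
    (hp.mono_of_module (Finset.subset_univ Q) fun h _ hh => hQ h hh) hpinj.injOn hu hρmin hpmin hr
    hur hne
  omega

theorem IntervalOn.exists_extend {V : Type*} [Fintype V] {G : SimpleGraph V} {p t f : V → ℕ}
    {v : V} (hp : LBFSOn G Finset.univ p) (hpinj : Function.Injective p)
    (ht : LBFSOn G Finset.univ t) (htinj : Function.Injective t)
    (hplus : ∀ v w, t v ≤ t w → (∀ h, t h < t v → (G.Adj h v ↔ G.Adj h w)) → p w ≤ p v)
    (hanch : ∀ u, ∀ Q : Finset V,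
      (∀ x, x ∈ Q ↔ p u ≤ p x ∧ ∀ h, p h < p u → (G.Adj h u ↔ G.Adj h x)) →
      (∀ r, G.Adj u r → p u < p r → r ∈ Q) →
      (∀ h, h ∉ Q → ∀ x ∈ Q, ∀ y ∈ Q, G.Adj h x → G.Adj h y) ∧
      ∃ ρ : V → ℕ, Function.Injective ρ ∧ IntervalOn G Q ρ ∧ ∀ a ∈ Q, ρ u ≤ ρ a)
    (hfinj : Function.Injective f) (hf : IntervalOn G Finset.univ f)
    (hpre : ∀ x y, t x < t v → (f x < f y ↔ t x < t y)) :
    ∃ f' : V → ℕ, Function.Injective f' ∧ IntervalOn G Finset.univ f' ∧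
      ∀ x y, t x ≤ t v → (f' x < f' y ↔ t x < t y) := by
  classical
  have hU : ∀ x : V, x ∈ Finset.univ := Finset.mem_univ
  obtain ⟨S, hS⟩ : ∃ S : Finset V, ∀ x, x ∈ S ↔
      t v ≤ t x ∧ ∀ h, t h < t v → (G.Adj h v ↔ G.Adj h x) :=
    ⟨Finset.univ.filter fun x => t v ≤ t x ∧ ∀ h, t h < t v → (G.Adj h v ↔ G.Adj h x), by simp⟩
  have hvS : v ∈ S := (hS v).2 ⟨le_rfl, by simp⟩
  have hvmax : ∀ s ∈ S, p s ≤ p v := fun s hs => hplus v s ((hS s).1 hs).1 ((hS s).1 hs).2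
  have hge : ∀ s ∈ S, t v ≤ t s := fun s hs => ((hS s).1 hs).1
  have hPS : ∀ x, t x < t v → x ∉ S := fun x hx h => absurd (hge x h) (by omega)
  have hPlt : ∀ x y, t x < t v → t v ≤ t y → f x < f y := fun x y hx hy =>
    (hpre x y hx).2 (by omega)
  have hPunif : ∀ x, t x < t v → ∀ s ∈ S, ∀ s' ∈ S, G.Adj x s → G.Adj x s' :=
    fun x hx s hs s' hs' h => (((hS s').1 hs').2 x hx).1 ((((hS s).1 hs).2 x hx).2 h)
  have hRlt' : ∀ s ∈ S, ∀ r, r ∉ S → t v ≤ t r → f s < f r ∧ t s < t r := by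
    intro s hs r hr hvr
    have hvr' : t v < t r := lt_of_le_of_ne hvr fun h => hr (htinj h ▸ hvS)
    have hne : s ≠ r := fun h => hr (h ▸ hs)
    obtain ⟨q, hq, hqv, hqr⟩ : ∃ q, t q < t v ∧ G.Adj q v ∧ ¬ G.Adj q r := by
      by_contra hcon
      push Not at hcon
      exact hr ((hS r).2 ⟨hvr, fun h hh => ⟨hcon h hh, ht.adj_of_adj (hU _) (hU _) hvr'
        (fun h _ => hcon h) (hU _) hh⟩⟩)
    have hqs := hPunif q hq v hvS s hs hqv
    constructor
    · by_contra hle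
      have : f r < f s := lt_of_le_of_ne (not_lt.1 hle) (hfinj.ne hne.symm)
      exact hqr (hf q (hU _) r (hU _) s (hU _) (hPlt q r hq hvr) this hqs)
    · by_contra hle
      refine hr ((hS r).2 ⟨hvr, fun h hh => ?_⟩)
      exact ht.tied_of_between htinj.injOn (hU v) (hU r) (hU s) hvr (not_lt.1 hle)
        (fun h _ hh => ((hS s).1 hs).2 h hh) h (hU _) hh
  have hRlt : ∀ s ∈ S, ∀ r, r ∉ S → t v ≤ t r → f s < f r := fun s hs r hr h =>
    (hRlt' s hs r hr h).1
  obtain ⟨R, hR⟩ := hf.exists_representsOn hfinj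
  obtain ⟨w, hw, hwmin⟩ := Finset.exists_min_image S R ⟨v, hvS⟩
  suffices h : ∃ T : Finset V, ∃ w : V, ∃ g : V → ℕ, T ⊆ S ∧ v ∈ T ∧ w ∈ T ∧
      Function.Injective g ∧ IntervalOn G T g ∧ (∀ x ∈ T, g v ≤ g x) ∧
      (∀ r, r ∉ S → t v ≤ t r → ∀ x ∈ T, G.Adj x r →
        ∀ x ∈ S, ∀ y ∈ S, x ≠ y → G.Adj x y) ∧
      (∀ s ∈ S, s ∉ T → ∀ x ∈ T, ∀ y ∈ T, G.Adj s x → G.Adj s y) ∧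
      (∀ x ∈ S, x ∉ T → G.Adj x w → ∀ y ∈ S, y ∉ T → G.Adj y w → x ≠ y → G.Adj x y) ∧
      (∀ x ∈ S, x ∉ T → G.Adj x w → ∀ y ∈ S, y ∉ T → ¬ G.Adj y w → f x < f y) by
    obtain ⟨T, w, g, hTS, hvT, hwT, hg, hgI, hgv, hright, hmod, hcl, hbef⟩ := h
    obtain ⟨f', hf', hI, hfv, hord⟩ := hf.exists_move_front hfinj (Finset.subset_univ S) hTS hvT
      hwT hg hgI hgv (fun a _ ha => by
        rcases lt_or_ge (t a) (t v) with h | h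
        · exact Or.inl ⟨fun s hs => hPlt a s h (hge s hs), hPunif a h⟩
        · exact Or.inr ⟨fun s hs => hRlt s hs a ha h, fun x hx => hright a ha h x hx⟩)
      hmod hcl hbef
    refine ⟨f', hf', hI, fun x y hx => ?_⟩
    rcases hx.lt_or_eq with hx | hx
    · rw [hord x (hU _) y (hU _) (Or.inl (hPS x hx)), hpre x y hx]
    · obtain rfl := htinj hx
      rcases eq_or_ne y x with rfl | hyx
      · simp
      have hne : t y ≠ t x := htinj.ne hyx
      by_cases hy : y ∈ S
      · have := hge y hy
        simp only [hfv y hy hyx, true_iff]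
        omega
      · rw [hord x (hU _) y (hU _) (Or.inr hy)]
        rcases lt_or_gt_of_ne hne with h | h
        · have := hPlt y x h le_rfl
          omega
        · simp [hRlt x hvS y hy h.le, h]
  by_cases hclq : ∀ x ∈ S, ∀ y ∈ S, x ≠ y → G.Adj x y
  · refine ⟨{v}, v, f, by simpa using hvS, by simp, by simp, hfinj, ?_, by simp,
      fun _ _ _ _ _ _ => hclq, ?_, fun x hx _ _ y hy _ _ => hclq x hx y hy, ?_⟩
    · simp [IntervalOn]
    · simp
    · intro x _ _ _ y hy hyv hn
      exact absurd (hclq y hy v hvS (by simpa using hyv)) hn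
  have hwR : ∀ r, r ∉ S → t v ≤ t r → ¬ G.Adj w r := by
    intro r hr hvr hwr
    refine hclq fun x hx y hy hxy => ?_
    have h1 := ((hR.2 w (hU _) r (hU _) hwr.ne).1 hwr).2
    have h2 := hRlt x hx r hr hvr
    have h3 := hRlt y hy r hr hvr
    have h4 := hwmin x hx
    have h5 := hwmin y hy
    exact (hR.2 x (hU _) y (hU _) hxy).2 ⟨by omega, by omega⟩
  obtain ⟨B, hB⟩ : ∃ B : Finset V, ∀ x, x ∈ B ↔ t v ≤ t x :=
    ⟨Finset.univ.filter fun x => t v ≤ t x, by simp⟩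
  obtain ⟨u, hu, huw, hpw, htied⟩ := hp.exists_tied hpinj.injOn (Finset.subset_univ B)
    (fun s hs => (hB s).2 (hge s hs))
    (⟨fun a ha => hR.1 a (hU _), fun a _ b _ => hR.2 a (hU _) b (hU _)⟩ : RepresentsOn G B f R)
    hw hwmin hvS hvmax
    (fun b hb hbS => (hRlt v hvS b hbS ((hB b).1 hb)).le.trans (hR.1 b (hU _)))
    (fun a _ ha => hPunif a (by simpa [hB] using ha))
  have huR : ∀ r, r ∉ S → t v ≤ t r → ¬ G.Adj u r := by
    intro r hr hvr hur
    rcases huw with rfl | huw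
    · exact hwR r hr hvr hur
    · have h1 := ((hR.2 u (hU _) r (hU _) hur.ne).1 hur).2
      have h2 := hRlt v hvS r hr hvr
      omega
  obtain ⟨Q, hQ⟩ : ∃ Q : Finset V, ∀ x, x ∈ Q ↔
      p u ≤ p x ∧ ∀ h, p h < p u → (G.Adj h u ↔ G.Adj h x) :=
    ⟨Finset.univ.filter fun x => p u ≤ p x ∧ ∀ h, p h < p u → (G.Adj h u ↔ G.Adj h x), by simp⟩
  have huQ : u ∈ Q := (hQ u).2 ⟨le_rfl, by simp⟩
  have hSQ : ∀ s ∈ S, p u ≤ p s → s ∈ Q := fun s hs hus => (hQ s).2 ⟨hus, fun h hh =>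
    hp.tied_of_between hpinj.injOn (hU u) (hU s) (hU v) hus (hvmax s hs) htied h (hU _) hh⟩
  obtain ⟨hQmod, ρ, hρinj, hρ, hρmin⟩ := hanch u Q hQ (by
    intro r hur hpr
    by_contra hrQ
    have hrS : r ∉ S := fun h => hrQ (hSQ r h hpr.le)
    have hrt : t r < t v := not_le.1 fun h => huR r hrS h hur
    obtain ⟨q, hq, hqu, hqr⟩ : ∃ q, p q < p u ∧ G.Adj q u ∧ ¬ G.Adj q r := by
      by_contra hcon
      push Not at hcon
      exact hrQ ((hQ r).2 ⟨hpr.le, fun h hh => ⟨hcon h hh, hp.adj_of_adj (hU _) (hU _) hpr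
        (fun h _ => hcon h) (hU _) hh⟩⟩)
    have hqS : q ∉ S := fun h => hqr (hPunif r hrt u hu q h hur.symm).symm
    have hqt : t q < t v := not_le.1 fun h => huR q hqS h hqu.symm
    refine hclq fun x hx y hy hxy => hR.adj_of_common_neighbors (c := q) (d := r) (hU _) (hU _)
      (hU _) (hU _) hxy ?_ (hPunif q hqt u hu x hx hqu) (hPunif q hqt u hu y hy hqu)
      (hPunif r hrt u hu x hx hur.symm) (hPunif r hrt u hu y hy hur.symm) hqr
    rintro rfl
    omega)
  have hQR : ∀ r, r ∉ S → t v ≤ t r → r ∉ Q := fun r hr hvr hrQ =>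
    hp.not_lt_of_plus hpinj ht hplus hQmod hρinj hρ huQ hρmin (fun a ha => ((hQ a).1 ha).1) hrQ
      (huR r hr hvr) (fun h => hr (h ▸ hu)) (hRlt' u hu r hr hvr).2
  have hTQ : ∀ x, x ∈ S.filter (fun s => p u ≤ p s) → x ∈ S ∧ x ∈ Q := fun x hx => by
    rw [Finset.mem_filter] at hx
    exact ⟨hx.1, hSQ x hx.1 hx.2⟩
  have hTmod : ∀ h, h ∉ S.filter (fun s => p u ≤ p s) → ∀ x ∈ S.filter (fun s => p u ≤ p s),
      ∀ y ∈ S.filter (fun s => p u ≤ p s), G.Adj h x → G.Adj h y := by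
    intro h hh x hx y hy
    obtain ⟨hxS, hxQ⟩ := hTQ x hx
    obtain ⟨hyS, hyQ⟩ := hTQ y hy
    by_cases hhQ : h ∈ Q
    · have hhS : h ∉ S := fun hS' => hh (Finset.mem_filter.2 ⟨hS', ((hQ h).1 hhQ).1⟩)
      exact hPunif h (not_le.1 fun hle => hQR h hhS hle hhQ) x hxS y hyS
    · exact hQmod h hhQ x hxQ y hyQ
  have hvT : v ∈ S.filter fun s => p u ≤ p s := by simp [hvS, hvmax u hu]
  have hwT : w ∈ S.filter fun s => p u ≤ p s := by simp [hw, hpw]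
  obtain ⟨g, hg, hgI, hgv⟩ := LBFSOn.exists_intervalOn_from_last (π := p)
    (fun a _ b _ c _ => hf a (hU _) b (hU _) c (hU _)) hfinj
    (hp.mono_of_module (Finset.subset_univ _) fun h _ => hTmod h) hpinj.injOn hvT
    (fun a ha => hvmax a (hTQ a ha).1)
  refine ⟨S.filter fun s => p u ≤ p s, w, g, Finset.filter_subset _ _, hvT, hwT, hg, hgI, hgv,
    fun r hr hvr x hx hxr => ?_, fun s _ => hTmod s, fun y hy _ hyw z hz _ hzw hyz => ?_,
    fun y hy _ hyw z hz hzT hzw => ?_⟩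
  · exact absurd (hQmod r (hQR r hr hvr) x (hTQ x hx).2 u huQ hxr.symm).symm (huR r hr hvr)
  · have h1 := (hR.2 y (hU _) w (hU _) hyw.ne).1 hyw
    have h2 := (hR.2 z (hU _) w (hU _) hzw.ne).1 hzw
    have h3 := hwmin y hy
    have h4 := hwmin z hz
    exact (hR.2 y (hU _) z (hU _) hyz).2 ⟨by omega, by omega⟩
  · have h1 := (hR.2 y (hU _) w (hU _) hyw.ne).1 hyw
    have h4 := hwmin z hz
    have h5 := hR.1 w (hU _)
    by_contra hle
    refine hzw ((hR.2 z (hU _) w (hU _) ?_).2 ⟨by omega, by omega⟩)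
    rintro rfl
    exact hzT hwT

theorem IsIntervalGraph.exists_intervalOn {V : Type*} [Finite V] {G : SimpleGraph V}
    (hG : IsIntervalGraph G) (A : Finset V) :
    ∃ f : V → ℕ, Function.Injective f ∧ IntervalOn G A f := by
  obtain ⟨I, hI, hadj⟩ := hG
  choose a b hab hIab using hI
  obtain ⟨f, hf, hfI, -⟩ := exists_key_of_representsOn (G := G) (A := A) (l := a) (r := b)
    ⟨fun x _ => hab x, fun x _ y _ hxy => by
      rw [hadj x y hxy, hIab, hIab, Set.Icc_inter_Icc, Set.nonempty_Icc]
      have h1 := hab x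
      have h2 := hab y
      simp only [sup_le_iff, le_inf_iff]
      tauto⟩
  exact ⟨f, hf, hfI⟩

theorem IsLBFSOrdering.lbfsOn {V : Type*} [Finite V] {G : SimpleGraph V}
    {σ : V ≃ Fin (Nat.card V)} (h : IsLBFSOrdering G σ) (A : Finset V) (hA : ∀ x, x ∈ A) :
    LBFSOn G A fun x => (σ x : ℕ) := fun a _ b _ c _ hab hbc hac hn => by
  obtain ⟨d, hd⟩ := h a b c hab hbc hac hn
  exact ⟨d, hA d, hd⟩

theorem mem_snapshot_iff {V : Type*} [Finite V] {G : SimpleGraph V} {σ : V ≃ Fin (Nat.card V)}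
    {u x : V} : x ∈ snapshot G σ u ↔
      σ u ≤ σ x ∧ ∀ h, σ h < σ u → (G.Adj h u ↔ G.Adj h x) := by
  simp only [snapshot, earlyNbhd, Set.mem_ofPred_eq, Set.ext_iff]
  refine and_congr_right fun _ => forall_congr' fun h => ?_
  tauto

/-- In a well-anchored ordering of an interval graph, a snapshot whose first vertex is not
exposed is a module with an interval ordering starting at that vertex. -/
theorem IsWellAnchored.module_of_not_exposed {V : Type*} [Finite V] {G : SimpleGraph V}
    (hG : IsIntervalGraph G) {σ : V ≃ Fin (Nat.card V)} (hσ : IsWellAnchored G σ) {u : V}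
    {Q : Finset V} (hQ : ∀ x, x ∈ Q ↔ x ∈ snapshot G σ u)
    (hexp : ∀ r, G.Adj u r → σ u < σ r → r ∈ Q) :
    (∀ h, h ∉ Q → ∀ x ∈ Q, ∀ y ∈ Q, G.Adj h x → G.Adj h y) ∧
      ∃ ρ : V → ℕ, Function.Injective ρ ∧ IntervalOn G Q ρ ∧ ∀ a ∈ Q, ρ u ≤ ρ a := by
  have huQ : u ∈ Q := (hQ u).2 (mem_snapshot_iff.2 ⟨le_rfl, by simp⟩)
  have hnot : ¬ ∃ v, ExposedFrom G σ u v := fun h => by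
    obtain ⟨-, r, hur, hr⟩ := (hσ.2 u).1 h
    simp only [Set.mem_union, not_or, ← hQ] at hr
    refine hr.2 (hexp r hur
      (lt_of_le_of_ne (not_lt.1 fun hlt => hr.1 ⟨hlt, hur.symm⟩) fun he => ?_))
    exact hr.2 (σ.injective he ▸ huQ)
  constructor
  · intro h hh x hx y hy hhx
    have hearly : h ∈ earlyNbhd G σ u := by
      by_contra hne
      refine hnot ⟨x, (hQ x).1 hx, h, hhx.symm, ?_⟩
      rintro (h' | h')
      · exact hne h'
      · exact hh ((hQ h).2 h')
    exact ((mem_snapshot_iff.1 ((hQ y).1 hy)).2 h hearly.1).1 hearly.2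
  · obtain ⟨f, hfinj, hf⟩ := hG.exists_intervalOn Q
    exact ((hσ.2 u).2 hnot).exists_intervalOn hQ hf hfinj

/-- if `π` is a well-anchored LBFS ordering of an interval graph `G`,
then `LBFS⁺(G, π)` is an interval ordering of `G`. -/
theorem lbfs_plus_of_well_anchored_is_interval_ordering {V : Type*} [Finite V]
    (G : SimpleGraph V) (hG : IsIntervalGraph G)
    (π πp : V ≃ Fin (Nat.card V))
    (hπ : IsWellAnchored G π) (hπp : IsLBFSPlusOf G π πp) :
    IsIntervalOrdering G πp := by
  have := Fintype.ofFinite V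
  have hinj : ∀ σ : V ≃ Fin (Nat.card V), Function.Injective fun x => (σ x : ℕ) :=
    fun σ => Fin.val_injective.comp σ.injective
  have key : ∀ k ≤ Nat.card V, ∃ f : V → ℕ, Function.Injective f ∧
      IntervalOn G Finset.univ f ∧
      ∀ x y, (πp x : ℕ) < k → (f x < f y ↔ (πp x : ℕ) < πp y) := by
    intro k
    induction k with
    | zero =>
      intro _
      obtain ⟨f, hf, hfI⟩ := hG.exists_intervalOn Finset.univ
      exact ⟨f, hf, hfI, fun x y h => absurd h (Nat.not_lt_zero _)⟩
    | succ k ih =>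
      intro hk
      obtain ⟨f, hf, hfI, hpre⟩ := ih (by omega)
      have hv : (πp (πp.symm ⟨k, hk⟩) : ℕ) = k := by simp
      obtain ⟨f', hf', hfI', hpre'⟩ := hfI.exists_extend (p := fun x => (π x : ℕ))
        (t := fun x => (πp x : ℕ)) (v := πp.symm ⟨k, hk⟩)
        (hπ.1.lbfsOn _ Finset.mem_univ) (hinj π) (hπp.1.lbfsOn _ Finset.mem_univ) (hinj πp)
        (fun v w hvw h => hπp.2 v w (mem_snapshot_iff.2 ⟨hvw, h⟩))
        (fun u Q hQ hexp => hπ.module_of_not_exposed hG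
          (fun x => (hQ x).trans mem_snapshot_iff.symm) hexp) hf
        (by simpa only [hv] using hpre)
      refine ⟨f', hf', hfI', fun x y h => hpre' x y ?_⟩
      simp only [hv]
      omega
  obtain ⟨f, -, hfI, hpre⟩ := key _ le_rfl
  exact fun u v w huv hvw => hfI u (Finset.mem_univ _) v (Finset.mem_univ _) w (Finset.mem_univ _)
    ((hpre u v (πp u).2).2 huv) ((hpre v w (πp v).2).2 hvw)
end
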